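/- Let d ∈ {1,2,3}, let Ω ⊆ ℝ^d be a nonempty bounded open set, let b, c > 0, k, σ ∈ ℝ, T > 0 and R > 0. There exist m > 0 and C > 0 (depending on d, Ω, b, c, k, σ, T, R) such that the following holds. Suppose α, ψ, f̃ : ℝ × ℝ^d → ℝ are admissible, the coefficient α satisfies N_T^v(α) ≤ R and the smallness condition |k|(sup_{t∈[0,T]}‖α(t)‖ + (∫₀ᵀ t‖α_t‖² dt)^{1/2}) + |σ|((∫₀ᵀ‖∇α‖² dt)^{1/2} + (∫₀ᵀ t‖∇α_t‖² dt)^{1/2}) ≤ m, and ψ solves the linearized Blackstock equation ψ_tt − c²(1 − 2k α)Δψ − b Δψ_t + 2σ ∇ψ·∇α = f̃ on [0,T] × Ω. Then N_T(ψ) ≤ C(‖ψ(0)‖_{H²} + ‖ψ_t(0)‖_{H¹} + (∫₀ᵀ‖f̃‖² dt)^{1/2} + sup_{t∈[0,T]}√t‖f̃(t)‖ + (∫₀ᵀ t‖f̃_t(t)‖_{H⁻¹(Ω)}² dt)^{1/2}). -/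

import Mathlib

open MeasureTheory Real

noncomputable section

/-- Euclidean space ℝ^d. -/
abbrev Spc (d : ℕ) := EuclideanSpace ℝ (Fin d)

variable {d : ℕ}

/-- Spatial Laplacian: sum of second derivatives in the coordinate directions. -/
def lap (g : Spc d → ℝ) (x : Spc d) : ℝ :=
  ∑ i, fderiv ℝ (fun y => fderiv ℝ g y (EuclideanSpace.single i 1)) x (EuclideanSpace.single i 1)

/-- Squared L²(Ω) norm: ‖g‖² = ∫_Ω g². -/
def sqL2 (Ω : Set (Spc d)) (g : Spc d → ℝ) : ℝ := ∫ x in Ω, (g x) ^ 2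

/-- Squared L²(Ω) norm of the gradient: ‖∇g‖² = ∫_Ω |∇g|². -/
def sqGrad (Ω : Set (Spc d)) (g : Spc d → ℝ) : ℝ := ∫ x in Ω, ‖gradient g x‖ ^ 2

/-- Squared L²(Ω) norm of the Hessian: ‖D²g‖² = ∫_Ω |D²g|². -/
def sqHess (Ω : Set (Spc d)) (g : Spc d → ℝ) : ℝ := ∫ x in Ω, ‖iteratedFDeriv ℝ 2 g x‖ ^ 2

/-- Squared H¹(Ω) norm. -/
def sqH1 (Ω : Set (Spc d)) (g : Spc d → ℝ) : ℝ := sqL2 Ω g + sqGrad Ω g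

/-- Squared H²(Ω) norm. -/
def sqH2 (Ω : Set (Spc d)) (g : Spc d → ℝ) : ℝ := sqL2 Ω g + sqGrad Ω g + sqHess Ω g

/-- H⁻¹(Ω) norm by duality against smooth compactly supported test functions. -/
def negH1 (Ω : Set (Spc d)) (g : Spc d → ℝ) : ℝ :=
  sSup { r : ℝ | ∃ φ : Spc d → ℝ, ContDiff ℝ (⊤ : ℕ∞) φ ∧ HasCompactSupport φ ∧ tsupport φ ⊆ Ω ∧
      (∫ x in Ω, ‖gradient φ x‖ ^ 2) ≤ 1 ∧ r = ∫ x in Ω, g x * φ x }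

/-- Admissible: smooth in (t,x), with spatial support in a fixed compact subset of Ω. -/
def Admissible (Ω : Set (Spc d)) (w : ℝ → Spc d → ℝ) : Prop :=
  ContDiff ℝ (⊤ : ℕ∞) (fun p : ℝ × Spc d => w p.1 p.2) ∧
  ∃ K : Set (Spc d), IsCompact K ∧ K ⊆ Ω ∧ ∀ t, Function.support (w t) ⊆ K

/-- Inner product of two spatial gradients: ∇g·∇h. -/
def gdot (g h : Spc d → ℝ) (x : Spc d) : ℝ := @inner ℝ _ _ (gradient g x) (gradient h x)

/-- Time derivative. -/
def tderiv (w : ℝ → Spc d → ℝ) (t : ℝ) (x : Spc d) : ℝ := deriv (fun s => w s x) t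

/-- The Blackstock equation ψ_tt − c²(1 − 2k ψ_t)Δψ − b Δψ_t + 2σ ∇ψ·∇ψ_t = 0
holds at time `t` on `Ω`. -/
def IsBlackstock (Ω : Set (Spc d)) (b c k σ : ℝ) (ψ : ℝ → Spc d → ℝ) (t : ℝ) : Prop :=
  ∀ x ∈ Ω,
    (tderiv (tderiv ψ) t x - c ^ 2 * (1 - 2 * k * tderiv ψ t x) * lap (ψ t) x
      - b * lap (tderiv ψ t) x
      + 2 * σ * gdot (ψ t) (tderiv ψ t) x) = 0

/-- Energy E(t). -/
def energy (Ω : Set (Spc d)) (b c : ℝ) (ψ : ℝ → Spc d → ℝ) (t : ℝ) : ℝ :=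
  (1 / 2) * sqL2 Ω (tderiv ψ t) + (c ^ 2 / 2) * sqGrad Ω (ψ t)
    + (c ^ 2 / (2 * b)) * sqL2 Ω (lap (ψ t)) + sqGrad Ω (tderiv ψ t)

/-- Dissipation D(t). -/
def dissip (Ω : Set (Spc d)) (ψ : ℝ → Spc d → ℝ) (t : ℝ) : ℝ :=
  ∫ s in (0:ℝ)..t,
    (sqGrad Ω (tderiv ψ s) + sqL2 Ω (lap (tderiv ψ s)) + sqGrad Ω (ψ s)
      + sqL2 Ω (lap (ψ s)) + sqL2 Ω (tderiv (tderiv ψ) s))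

/-- Supremum of a function of time over [0,T]. -/
def supIcc (T : ℝ) (f : ℝ → ℝ) : ℝ := ⨆ t : Set.Icc (0:ℝ) T, f t

/-- f := −2k c² ψ_t Δψ − 2σ ∇ψ·∇ψ_t, the right-hand side nonlinearity. -/
def blackF (c k σ : ℝ) (ψ : ℝ → Spc d → ℝ) (t : ℝ) (x : Spc d) : ℝ :=
  -(2 * k * c ^ 2) * tderiv ψ t x * lap (ψ t) x - 2 * σ * gdot (ψ t) (tderiv ψ t) x

/-- The nonlocal heat equation v_t − b Δv − c² Δψ = f (with v = ψ_t) holds at time `t` on `Ω`. -/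
def IsHeat (Ω : Set (Spc d)) (b c : ℝ) (ψ f : ℝ → Spc d → ℝ) (t : ℝ) : Prop :=
  ∀ x ∈ Ω,
    tderiv (tderiv ψ) t x - b * lap (tderiv ψ t) x - c ^ 2 * lap (ψ t) x = f t x

/-- The linearized Blackstock equation
ψ_tt − c²(1 − 2k α)Δψ − b Δψ_t + 2σ ∇ψ·∇α = f̃ holds at time `t` on `Ω`. -/
def IsLinBlackstock (Ω : Set (Spc d)) (b c k σ : ℝ) (α ψ f : ℝ → Spc d → ℝ) (t : ℝ) : Prop :=
  ∀ x ∈ Ω,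
    tderiv (tderiv ψ) t x - c ^ 2 * (1 - 2 * k * α t x) * lap (ψ t) x
      - b * lap (tderiv ψ t) x + 2 * σ * gdot (ψ t) (α t) x = f t x

/-- Time-weighted norm N_T^v for the velocity variable. -/
def normV (Ω : Set (Spc d)) (T : ℝ) (α : ℝ → Spc d → ℝ) : ℝ :=
  supIcc T (fun t => Real.sqrt (sqH1 Ω (α t)))
    + Real.sqrt (∫ t in (0:ℝ)..T, (sqL2 Ω (α t) + sqGrad Ω (α t) + sqL2 Ω (lap (α t))))
    + Real.sqrt (∫ t in (0:ℝ)..T, sqL2 Ω (tderiv α t))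
    + supIcc T (fun t => Real.sqrt t * Real.sqrt (sqL2 Ω (tderiv α t)))
    + Real.sqrt (∫ t in (0:ℝ)..T, t * sqGrad Ω (tderiv α t))
    + supIcc T (fun t => Real.sqrt t * Real.sqrt (sqL2 Ω (lap (α t))))

/-- Time-weighted solution norm N_T(ψ) = sup_{[0,T]} ‖ψ(t)‖_{H²} + N_T^v(ψ_t). -/
def normX (Ω : Set (Spc d)) (T : ℝ) (ψ : ℝ → Spc d → ℝ) : ℝ :=
  supIcc T (fun t => Real.sqrt (sqH2 Ω (ψ t))) + normV Ω T (tderiv ψ)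

section

/-- Partial derivative. -/
def pd (i : Fin d) (g : Spc d → ℝ) (x : Spc d) : ℝ := fderiv ℝ g x (EuclideanSpace.single i 1)

lemma lap_eq (g : Spc d → ℝ) (x : Spc d) : lap g x = ∑ i, pd i (pd i g) x := rfl

/-- Smooth with compact support in Ω. -/
structure Sm (Ω : Set (Spc d)) (g : Spc d → ℝ) : Prop where
  cd : ContDiff ℝ (⊤ : ℕ∞) g
  hc : HasCompactSupport g
  ts : tsupport g ⊆ Ω

variable {Ω : Set (Spc d)} {g h : Spc d → ℝ}

lemma Sm.cont (hg : Sm Ω g) : Continuous g := hg.cd.continuous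
lemma Sm.diff (hg : Sm Ω g) : Differentiable ℝ g := hg.cd.differentiable (by simp)
lemma Sm.int (hg : Sm Ω g) : Integrable g := hg.cont.integrable_of_hasCompactSupport hg.hc

lemma Sm.mul_left (hg : Sm Ω g) (hh : ContDiff ℝ (⊤ : ℕ∞) h) : Sm Ω (fun x => g x * h x) :=
  ⟨hg.cd.mul hh, hg.hc.mul_right, (tsupport_mul_subset_left (f := g) (g := h)).trans hg.ts⟩

lemma Sm.mul (hg : Sm Ω g) (hh : Sm Ω h) : Sm Ω (fun x => g x * h x) := hg.mul_left hh.cd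

lemma Sm.add (hg : Sm Ω g) (hh : Sm Ω h) : Sm Ω (fun x => g x + h x) :=
  ⟨hg.cd.add hh.cd, hg.hc.add hh.hc,
    (tsupport_add g h).trans (Set.union_subset hg.ts hh.ts)⟩

lemma Sm.smul (hg : Sm Ω g) (r : ℝ) : Sm Ω (fun x => r * g x) := by
  simpa [mul_comm] using hg.mul_left (h := fun _ => r) contDiff_const

lemma Sm.sq (hg : Sm Ω g) : Sm Ω (fun x => g x ^ 2) := by
  simpa [pow_two] using hg.mul hg

lemma Sm.pow4 (hg : Sm Ω g) : Sm Ω (fun x => g x ^ 4) := by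
  have := hg.sq.sq
  simpa only [← pow_mul] using this

lemma Sm.sub (hg : Sm Ω g) (hh : Sm Ω h) : Sm Ω (fun x => g x - h x) := by
  simpa [sub_eq_add_neg] using hg.add (hh.smul (-1))

lemma Sm.zero : Sm Ω (fun _ => 0) := ⟨contDiff_const, HasCompactSupport.zero, by
  have : tsupport (fun _ : Spc d => (0:ℝ)) = ∅ := by simp
  simp [this]⟩

lemma Sm.sum {ι : Type*} (s : Finset ι) {G : ι → Spc d → ℝ} (hG : ∀ i, Sm Ω (G i)) :
    Sm Ω (fun x => ∑ i ∈ s, G i x) := by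
  classical
  induction s using Finset.induction_on with
  | empty => simpa using Sm.zero
  | insert a s ha ih => simpa [Finset.sum_insert ha] using (hG a).add ih

lemma Sm.px (hg : Sm Ω g) (i : Fin d) : Sm Ω (pd i g) := by
  refine ⟨?_, ?_, ?_⟩
  · exact (hg.cd.fderiv_right (m := (⊤ : ℕ∞)) (by simp)).clm_apply contDiff_const
  · exact hg.hc.fderiv_apply (𝕜 := ℝ) _
  · exact (tsupport_fderiv_apply_subset ℝ _).trans hg.ts

lemma Sm.lp (hg : Sm Ω g) : Sm Ω (lap g) := by
  have : lap g = fun x => ∑ i, pd i (pd i g) x := by ext x; rfl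
  rw [this]
  exact Sm.sum _ fun i => (hg.px i).px i

lemma Sm.zero_off (hg : Sm Ω g) {x : Spc d} (hx : x ∉ Ω) : g x = 0 := by
  by_contra h
  exact hx (hg.ts (subset_tsupport _ h))

lemma Sm.setInt (hg : Sm Ω g) : ∫ x in Ω, g x = ∫ x, g x :=
  setIntegral_eq_integral_of_forall_compl_eq_zero fun _ hx => hg.zero_off hx

lemma pd_mul (hg : Sm Ω g) (hh : Sm Ω h) (i : Fin d) (x : Spc d) :
    pd i (fun x => g x * h x) x = pd i g x * h x + g x * pd i h x := by
  unfold pd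
  rw [fderiv_fun_mul (hg.diff x) (hh.diff x)]
  simp; ring

lemma pd_smul (hg : Sm Ω g) (r : ℝ) (i : Fin d) (x : Spc d) :
    pd i (fun x => r * g x) x = r * pd i g x := by
  unfold pd
  rw [fderiv_const_mul (hg.diff x)]
  simp

lemma pd_comm (hg : Sm Ω g) (i j : Fin d) (x : Spc d) : pd i (pd j g) x = pd j (pd i g) x := by
  have hs : IsSymmSndFDerivAt ℝ g x :=
    (hg.cd.contDiffAt).isSymmSndFDerivAt (by simpa using (WithTop.coe_le_coe.2 (le_top : (2:ℕ∞) ≤ ⊤)))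
  have hd : DifferentiableAt ℝ (fderiv ℝ g) x :=
    (hg.cd.fderiv_right (m := (⊤ : ℕ∞)) (by simp)).differentiable (by simp) x
  have e : ∀ i j : Fin d, pd i (pd j g) x =
      fderiv ℝ (fderiv ℝ g) x (EuclideanSpace.single i 1) (EuclideanSpace.single j 1) := by
    intro i j
    unfold pd
    rw [fderiv_clm_apply hd (differentiableAt_const _)]
    simp
  rw [e, e]; exact hs _ _

lemma ibp (hg : Sm Ω g) (hh : Sm Ω h) (i : Fin d) :
    ∫ x, g x * pd i h x = - ∫ x, pd i g x * h x :=
  integral_mul_fderiv_eq_neg_fderiv_mul_of_integrable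
    ((hg.px i).mul hh).int (hg.mul (hh.px i)).int (hg.mul hh).int
    (fun x _ => hg.diff x) (fun x _ => hh.diff x)

lemma grad_apply (g : Spc d → ℝ) (x : Spc d) (i : Fin d) : gradient g x i = pd i g x := by
  have h := InnerProductSpace.toDual_symm_apply (𝕜 := ℝ)
    (x := EuclideanSpace.single i (1:ℝ)) (y := fderiv ℝ g x)
  unfold gradient pd
  rw [← h, EuclideanSpace.inner_single_right]
  simp

lemma gdot_eq (g h : Spc d → ℝ) (x : Spc d) : gdot g h x = ∑ i, pd i g x * pd i h x := by
  unfold gdot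
  rw [PiLp.inner_apply]
  exact Finset.sum_congr rfl fun i _ => by
    simp [grad_apply, mul_comm]

lemma norm_grad_sq (g : Spc d → ℝ) (x : Spc d) :
    ‖gradient g x‖ ^ 2 = ∑ i, pd i g x ^ 2 := by
  rw [EuclideanSpace.norm_sq_eq]
  simp [grad_apply]

lemma Sm.l2 (hg : Sm Ω g) : sqL2 Ω g = ∫ x, g x ^ 2 := hg.sq.setInt

lemma Sm.gr (hg : Sm Ω g) : sqGrad Ω g = ∑ i, ∫ x, pd i g x ^ 2 := by
  unfold sqGrad
  simp_rw [norm_grad_sq]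
  rw [(Sm.sum _ fun i => (hg.px i).sq).setInt, integral_finset_sum]
  exact fun i _ => (hg.px i).sq.int

end

section

variable {Ω : Set (Spc d)} {g h : Spc d → ℝ}

lemma cs_gen {X : Type*} [MeasurableSpace X] {μ : Measure X} {g h : X → ℝ}
    (hg : Integrable (fun x => g x ^ 2) μ) (hh : Integrable (fun x => h x ^ 2) μ)
    (hgh : Integrable (fun x => g x * h x) μ) :
    (∫ x, g x * h x ∂μ) ^ 2 ≤ (∫ x, g x ^ 2 ∂μ) * ∫ x, h x ^ 2 ∂μ := by
  have key : ∀ r : ℝ, 0 ≤ (∫ x, h x ^ 2 ∂μ) * (r * r) + (2 * ∫ x, g x * h x ∂μ) * r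
      + ∫ x, g x ^ 2 ∂μ := by
    intro r
    have e : ∫ x, (g x + r * h x) ^ 2 ∂μ = (∫ x, h x ^ 2 ∂μ) * (r * r)
        + (2 * ∫ x, g x * h x ∂μ) * r + ∫ x, g x ^ 2 ∂μ := by
      have : ∀ x, (g x + r * h x) ^ 2 = (r * r) * h x ^ 2 + (2 * r) * (g x * h x) + g x ^ 2 := by
        intro x; ring
      simp_rw [this]
      have i1 : Integrable (fun x => (r * r) * h x ^ 2) μ := hh.const_mul _
      have i2 : Integrable (fun x => (2 * r) * (g x * h x)) μ := hgh.const_mul _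
      have i3 : Integrable (fun x => (r * r) * h x ^ 2 + (2 * r) * (g x * h x)) μ := i1.add i2
      rw [integral_add i3 hg, integral_add i1 i2, integral_const_mul, integral_const_mul]
      ring
    rw [← e]
    exact integral_nonneg fun x => sq_nonneg _
  have := discrim_le_zero key
  unfold discrim at this
  nlinarith

lemma cs (hg : Sm Ω g) (hh : Sm Ω h) :
    (∫ x, g x * h x) ^ 2 ≤ (∫ x, g x ^ 2) * ∫ x, h x ^ 2 :=
  cs_gen hg.sq.int hh.sq.int (hg.mul hh).int

lemma int_sq_nonneg (g : Spc d → ℝ) : 0 ≤ ∫ x, g x ^ 2 := integral_nonneg fun x => sq_nonneg _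

lemma l4_prod {B D : ℝ} (hB : 0 ≤ B) (hD : 0 ≤ D) {b c : Spc d → ℝ} (hb : Sm Ω b) (hc : Sm Ω c)
    (h1 : ∫ x, b x ^ 4 ≤ B ^ 2) (h2 : ∫ x, c x ^ 4 ≤ D ^ 2) :
    ∫ x, (b x * c x) ^ 2 ≤ B * D := by
  have := cs hb.sq hc.sq
  simp only [← pow_mul] at this
  norm_num only at this
  have e : ∫ x, (b x * c x) ^ 2 = ∫ x, b x ^ 2 * c x ^ 2 := by simp_rw [mul_pow]
  rw [e]
  refine abs_le_of_sq_le_sq' ?_ (mul_nonneg hB hD) |>.2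
  refine this.trans ?_
  rw [mul_pow]
  exact mul_le_mul h1 h2 (integral_nonneg fun x => by positivity) (by positivity)

lemma tri {B D : ℝ} (hB : 0 ≤ B) (hD : 0 ≤ D) {a b c : Spc d → ℝ} (ha : Sm Ω a) (hb : Sm Ω b)
    (hc : Sm Ω c) (h1 : ∫ x, b x ^ 4 ≤ B ^ 2) (h2 : ∫ x, c x ^ 4 ≤ D ^ 2) :
    (∫ x, a x * (b x * c x)) ^ 2 ≤ (∫ x, a x ^ 2) * (B * D) :=
  (cs ha (hb.mul hc)).trans
    (mul_le_mul_of_nonneg_left (l4_prod hB hD hb hc h1 h2) (int_sq_nonneg a))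

lemma norm_fderiv_sq (g : Spc d → ℝ) (x : Spc d) :
    ‖fderiv ℝ g x‖ ^ 2 = ∑ i, pd i g x ^ 2 := by
  rw [← norm_grad_sq]; unfold gradient; simp

/-- sum of squares of first derivatives -/
def G (g : Spc d → ℝ) : ℝ := ∑ i, ∫ x, pd i g x ^ 2
/-- L2 square of the Laplacian -/
def L (g : Spc d → ℝ) : ℝ := ∫ x, lap g x ^ 2

lemma G_nonneg (g : Spc d → ℝ) : 0 ≤ G g := Finset.sum_nonneg fun _ _ => int_sq_nonneg _
lemma L_nonneg (g : Spc d → ℝ) : 0 ≤ L g := int_sq_nonneg _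

lemma Sm.G_eq (hg : Sm Ω g) : G g = ∫ x, ‖fderiv ℝ g x‖ ^ 2 := by
  simp_rw [norm_fderiv_sq]
  rw [integral_finsetSum _ fun i _ => (hg.px i).sq.int]
  rfl

lemma gns (hbd : Bornology.IsBounded Ω) (p : NNReal) (hp : 1 ≤ p) (hp2 : p ≤ 2)
    (hpd : p < d) (hpq : (p:ℝ)⁻¹ - (d:ℝ)⁻¹ ≤ 4⁻¹) :
    ∃ K : ℝ, 0 ≤ K ∧ ∀ w, Sm Ω w → ∫ x, w x ^ 4 ≤ (K * G w) ^ 2 := by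
  have hfin : volume Ω < ⊤ := hbd.measure_lt_top
  set A : ENNReal := (eLpNormLESNormFDerivOfLeConst ℝ (volume : Measure (Spc d)) Ω p 4 : ENNReal) *
    volume Ω ^ (1 / (p : ENNReal).toReal - 1 / (2 : ENNReal).toReal) with hA
  have hAtop : A ≠ ⊤ := by
    apply ENNReal.mul_ne_top ENNReal.coe_ne_top
    apply ENNReal.rpow_ne_top_of_nonneg _ hfin.ne
    have hp0 : (0:ℝ) < p := by exact_mod_cast (zero_lt_one.trans_le hp)
    have hp2' : (p:ℝ) ≤ 2 := by exact_mod_cast hp2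
    simp only [ENNReal.coe_toReal, ENNReal.toReal_ofNat, sub_nonneg]
    gcongr
  refine ⟨A.toReal ^ 2, by positivity, fun w hw => ?_⟩
  have h1 := eLpNorm_le_eLpNorm_fderiv_of_le (μ := (volume : Measure (Spc d))) (F := ℝ) (u := w)
    (s := Ω) (hw.cd.of_le (by simp)) (fun x hx => hw.ts (subset_tsupport _ hx)) (p := p) (q := 4)
    hp (by simpa using hpd) (by simpa using hpq) hbd
  have hcont : Continuous (fderiv ℝ w) := hw.cd.continuous_fderiv (by simp)
  have hsupp : Function.support (fderiv ℝ w) ⊆ Ω :=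
    fun x hx => hw.ts (support_fderiv_subset ℝ hx)
  have h2 : eLpNorm (fderiv ℝ w) p volume ≤
      eLpNorm (fderiv ℝ w) 2 volume * volume Ω ^ (1 / (p : ENNReal).toReal - 1 / (2 : ENNReal).toReal) := by
    rw [← eLpNorm_norm (fderiv ℝ w), ← eLpNorm_norm (p := 2) (fderiv ℝ w)]
    have hsn : Function.support (fun x => ‖fderiv ℝ w x‖) ⊆ Ω := by
      intro x hx
      apply hsupp
      intro h0
      apply hx
      simp only [h0, norm_zero]
    have hs : ∀ q : ENNReal, eLpNorm (fun x => ‖fderiv ℝ w x‖) q (volume.restrict Ω) =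
        eLpNorm (fun x => ‖fderiv ℝ w x‖) q volume := fun q =>
      eLpNorm_restrict_eq_of_support_subset hsn
    rw [← hs, ← hs]
    have := eLpNorm_le_eLpNorm_mul_rpow_measure_univ (μ := volume.restrict Ω)
      (f := fun x => ‖fderiv ℝ w x‖) (p := (p:ENNReal)) (q := 2) (by exact_mod_cast hp2)
      hcont.norm.aestronglyMeasurable
    simpa using this
  have h3 : eLpNorm w 4 volume ≤ A * eLpNorm (fderiv ℝ w) 2 volume := by
    refine h1.trans ?_
    rw [hA, mul_assoc, mul_comm (volume Ω ^ _)]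
    gcongr
  have hm4 : MemLp w 4 volume := hw.cont.memLp_of_hasCompactSupport hw.hc
  have hm2 : MemLp (fderiv ℝ w) 2 volume := hcont.memLp_of_hasCompactSupport (hw.hc.fderiv ℝ)
  rw [hm4.eLpNorm_eq_integral_rpow_norm (by simp) (by simp),
    hm2.eLpNorm_eq_integral_rpow_norm (by simp) (by simp), ← ENNReal.ofReal_toReal hAtop,
    ← ENNReal.ofReal_mul (by positivity), ENNReal.ofReal_le_ofReal_iff (by positivity)] at h3
  simp only [ENNReal.toReal_ofNat] at h3
  have e4 : ∫ x, ‖w x‖ ^ (4:ℝ) = ∫ x, w x ^ 4 := by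
    refine integral_congr_ae (Filter.Eventually.of_forall fun x => ?_)
    simp only [Real.norm_eq_abs]
    rw [show (4:ℝ) = ((4:ℕ):ℝ) by norm_num, Real.rpow_natCast]
    exact (show Even 4 by decide).pow_abs _
  have e2 : ∫ x, ‖fderiv ℝ w x‖ ^ (2:ℝ) = G w := by
    rw [hw.G_eq]; simp
  rw [e4, e2] at h3
  have h40 : 0 ≤ ∫ x, w x ^ 4 := integral_nonneg fun x => by positivity
  have hG := G_nonneg w
  have h5 := pow_le_pow_left₀ (by positivity) h3 4
  rw [← Real.rpow_natCast, ← Real.rpow_mul h40] at h5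
  rw [mul_pow, ← Real.rpow_natCast (G w ^ _), ← Real.rpow_mul hG] at h5
  norm_num at h5
  nlinarith

end

section

variable {Ω : Set (Spc d)} {g h : Spc d → ℝ}

lemma one_dim_sup {Ω : Set (Spc 1)} {w : Spc 1 → ℝ} (hw : Sm Ω w) (x : Spc 1) :
    |w x| ≤ ∫ y, |pd 0 w y| := by
  let e : ℝ →L[ℝ] Spc 1 := ContinuousLinearMap.toSpanSingleton ℝ (EuclideanSpace.single (0 : Fin 1) (1:ℝ))
  have he : ∀ s : ℝ, e s = EuclideanSpace.single (0 : Fin 1) s := by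
    intro s; ext i; simp [e]
  have hinv : ∀ y : Spc 1, e (y 0) = y := by
    intro y; rw [he]; ext i; fin_cases i; simp
  have hcd : ContDiff ℝ 1 (fun s => w (e s)) := (hw.cd.of_le (by simp)).comp e.contDiff
  have hcs : HasCompactSupport (fun s => w (e s)) := by
    refine hw.hc.comp_isClosedEmbedding (g := e) ?_
    have hiso : Isometry e := by
      refine AddMonoidHomClass.isometry_of_norm e fun s => ?_
      rw [he]; simp
    exact hiso.isClosedEmbedding
  have hder : ∀ s, deriv (fun s => w (e s)) s = pd 0 w (e s) := by
    intro s
    have := ((hw.diff (e s)).hasFDerivAt.comp_hasDerivAt s e.hasDerivAt).deriv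
    rw [show (fun s => w (e s)) = w ∘ e from rfl, this]
    unfold pd
    rw [he 1]
  have hmp := (EuclideanSpace.volume_preserving_symm_measurableEquiv_toLp (Fin 1))
  have hmp2 := (volume_preserving_funUnique (Fin 1) ℝ)
  have hInt1 : ∫ s, |pd 0 w (e s)| = ∫ y, |pd 0 w y| := by
    have hmp3 := hmp2.comp hmp
    have hemb : MeasurableEmbedding ((MeasurableEquiv.funUnique (Fin 1) ℝ) ∘
        (MeasurableEquiv.toLp 2 (Fin 1 → ℝ)).symm) :=
      (MeasurableEquiv.measurableEmbedding _).comp (MeasurableEquiv.measurableEmbedding _)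
    rw [← hmp3.integral_comp hemb]
    refine integral_congr_ae (Filter.Eventually.of_forall fun y => ?_)
    simp only
    rw [show e _ = y from ?_]
    convert! hinv y using 1
  have h1 := hcs.integral_Iic_deriv_eq hcd (x 0)
  rw [hinv] at h1
  rw [← hInt1, ← h1]
  have hI : Integrable (fun s => deriv (fun s => w (e s)) s) :=
    (hcd.continuous_deriv (by simp)).integrable_of_hasCompactSupport hcs.deriv
  calc _ ≤ ∫ s in Set.Iic (x 0), |deriv (fun s => w (e s)) s| := abs_integral_le_integral_abs
    _ ≤ ∫ s, |deriv (fun s => w (e s)) s| :=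
      setIntegral_le_integral hI.abs (Filter.Eventually.of_forall fun s => abs_nonneg _)
    _ = _ := by simp_rw [hder]

lemma l1_le (hop : IsOpen Ω) (hbd : Bornology.IsBounded Ω) (hg : Sm Ω g) :
    (∫ x, |g x|) ^ 2 ≤ (∫ x, g x ^ 2) * volume.real Ω := by
  have e1 : ∫ x, |g x| = ∫ x in Ω, |g x| * 1 := by
    rw [setIntegral_eq_integral_of_forall_compl_eq_zero]
    · simp
    · intro x hx; simp [hg.zero_off hx]
  have hfin : volume Ω ≠ ⊤ := hbd.measure_lt_top.ne
  have hc1 : IntegrableOn (fun _ : Spc d => (1:ℝ)) Ω := by simp [hfin.lt_top]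
  have := cs_gen (μ := volume.restrict Ω) (g := fun x => |g x|) (h := fun _ => 1)
    (by simp only [sq_abs]; exact hg.sq.int.integrableOn) (by simp only [one_pow]; exact hc1)
    (by simp only [mul_one]; exact hg.int.abs.integrableOn)
  rw [e1]
  refine this.trans_eq ?_
  simp only [sq_abs, one_pow]
  rw [hg.sq.setInt]
  simp

lemma l4 (hd : d = 1 ∨ d = 2 ∨ d = 3) (hop : IsOpen Ω) (hbd : Bornology.IsBounded Ω) :
    ∃ K : ℝ, 0 ≤ K ∧ ∀ w, Sm Ω w → ∫ x, w x ^ 4 ≤ (K * G w) ^ 2 := by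
  rcases hd with rfl | rfl | rfl
  · set V := volume.real Ω
    have hV : 0 ≤ V := measureReal_nonneg
    have hfin : volume Ω ≠ ⊤ := hbd.measure_lt_top.ne
    refine ⟨V * √V, by positivity, fun w hw => ?_⟩
    have hb : ∀ x, w x ^ 4 ≤ (G w * V) ^ 2 := by
      intro x
      have h1 := one_dim_sup hw x
      have h2 := l1_le hop hbd (hw.px 0)
      have h3 : (∫ x, pd 0 w x ^ 2) = G w := by simp [G]
      rw [h3] at h2
      have h4 : w x ^ 2 ≤ G w * V := by
        rw [← sq_abs]
        exact (pow_le_pow_left₀ (abs_nonneg _) h1 2).trans h2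
      calc w x ^ 4 = (w x ^ 2) ^ 2 := by ring
        _ ≤ _ := pow_le_pow_left₀ (sq_nonneg _) h4 2
    rw [← hw.pow4.setInt]
    calc ∫ x in Ω, w x ^ 4 ≤ ∫ x in Ω, (G w * V) ^ 2 := by
          refine integral_mono hw.pow4.int.integrableOn ?_ hb
          exact integrableOn_const hfin
      _ = V * (G w * V) ^ 2 := by simp [V]
      _ = _ := by
        rw [mul_pow, mul_pow, mul_pow, Real.sq_sqrt hV]; ring
  · exact gns hbd (4/3) (by rw [← NNReal.coe_le_coe]; push_cast; norm_num) (by rw [← NNReal.coe_le_coe]; push_cast; norm_num) (by rw [← NNReal.coe_lt_coe]; push_cast; norm_num) (by push_cast; norm_num)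
  · exact gns hbd 2 (by norm_num) le_rfl (by norm_num) (by push_cast; norm_num)

lemma poinc (hd : d = 1 ∨ d = 2 ∨ d = 3) (hop : IsOpen Ω) (hbd : Bornology.IsBounded Ω) :
    ∃ K : ℝ, 0 ≤ K ∧ ∀ w, Sm Ω w → ∫ x, w x ^ 2 ≤ K * G w := by
  obtain ⟨K, hK, h⟩ := l4 hd hop hbd
  refine ⟨K * √(volume.real Ω), by positivity, fun w hw => ?_⟩
  have h1 := l1_le hop hbd hw.sq
  simp only [abs_sq, ← pow_mul] at h1
  norm_num only at h1
  have h2 := h w hw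
  have hV : 0 ≤ volume.real Ω := measureReal_nonneg
  refine (abs_le_of_sq_le_sq' ?_ (by have := G_nonneg w; positivity)).2
  refine h1.trans ((mul_le_mul_of_nonneg_right h2 hV).trans_eq ?_)
  rw [mul_pow, mul_pow, mul_pow, Real.sq_sqrt hV]; ring

/-- sum of squares of second derivatives -/
def H (g : Spc d → ℝ) : ℝ := ∑ i, G (pd i g)

lemma hess_eq (hg : Sm Ω g) : H g = L g := by
  have e1 : ∀ i j : Fin d, ∫ x, pd j (pd i g) x ^ 2 = ∫ x, pd i (pd i g) x * pd j (pd j g) x := by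
    intro i j
    have a1 := ibp ((hg.px i).px j) (hg.px i) j
    have a2 := ibp ((hg.px j).px j) (hg.px i) i
    have e : ∀ x, pd i (pd j (pd j g)) x = pd j (pd j (pd i g)) x := by
      intro x
      rw [pd_comm (hg.px j)]
      congr 1
      ext y
      exact pd_comm hg i j y
    have b1 : ∫ x, pd j (pd i g) x ^ 2 = - ∫ x, pd j (pd j (pd i g)) x * pd i g x := by
      rw [← a1]; simp_rw [pow_two]
    have b2 : ∫ x, pd i (pd i g) x * pd j (pd j g) x = - ∫ x, pd j (pd j (pd i g)) x * pd i g x := by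
      simp_rw [← e, ← a2]
      simp_rw [mul_comm]
    rw [b1, b2]
  unfold H L G
  simp_rw [e1, lap_eq, pow_two, Finset.sum_mul_sum]
  rw [integral_finsetSum _ fun i _ => ?_]
  · refine Finset.sum_congr rfl fun i _ => ?_
    rw [integral_finsetSum _ fun j _ => ?_]
    exact (((hg.px i).px i).mul ((hg.px j).px j)).int
  · exact (Sm.sum _ fun j => (((hg.px i).px i).mul ((hg.px j).px j))).int

/-- Green identity -/
lemma green (hg : Sm Ω g) (hh : Sm Ω h) :
    ∑ i, ∫ x, pd i g x * pd i h x = - ∫ x, g x * lap h x := by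
  have : ∫ x, g x * lap h x = ∑ i, ∫ x, g x * pd i (pd i h) x := by
    simp_rw [lap_eq, Finset.mul_sum]
    exact integral_finsetSum _ fun i _ => (hg.mul ((hh.px i).px i)).int
  rw [this, ← Finset.sum_neg_distrib]
  refine Finset.sum_congr rfl fun i _ => ?_
  rw [ibp hg (hh.px i) i]; ring

lemma G_eq_green (hg : Sm Ω g) : G g = - ∫ x, g x * lap g x := by
  rw [← green hg hg]; simp_rw [G, pow_two]

lemma grad_le_lap (hd : d = 1 ∨ d = 2 ∨ d = 3) (hop : IsOpen Ω) (hbd : Bornology.IsBounded Ω) :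
    ∃ K : ℝ, 0 ≤ K ∧ ∀ w, Sm Ω w → G w ≤ K * L w := by
  obtain ⟨K, hK, h⟩ := poinc hd hop hbd
  refine ⟨K, hK, fun w hw => ?_⟩
  have h1 := h w hw
  have h2 := cs hw hw.lp
  have h3 := G_eq_green hw
  have h4 : G w ^ 2 ≤ (∫ x, w x ^ 2) * L w := by rw [h3]; simpa [L] using h2
  have hG := G_nonneg w
  have hL := L_nonneg w
  rcases hG.eq_or_lt with h0 | h0
  · rw [← h0]; positivity
  · have : G w * G w ≤ G w * (K * L w) := by nlinarith [mul_le_mul_of_nonneg_right h1 hL]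
    exact le_of_mul_le_mul_left this h0

lemma grad4 (hd : d = 1 ∨ d = 2 ∨ d = 3) (hop : IsOpen Ω) (hbd : Bornology.IsBounded Ω) :
    ∃ K : ℝ, 0 ≤ K ∧ ∀ w, Sm Ω w → ∀ i, ∫ x, pd i w x ^ 4 ≤ (K * L w) ^ 2 := by
  obtain ⟨K, hK, h⟩ := l4 hd hop hbd
  refine ⟨K, hK, fun w hw i => (h _ (hw.px i)).trans ?_⟩
  have h1 : G (pd i w) ≤ L w := by
    rw [← hess_eq hw]
    exact Finset.single_le_sum (f := fun i => G (pd i w)) (fun i _ => G_nonneg _) (Finset.mem_univ i)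
  have := G_nonneg (pd i w)
  gcongr

end

section

variable {Ω : Set (Spc d)} {g h : Spc d → ℝ}

section four
open SchwartzMap FourierTransform Laplacian LineDeriv

lemma fderiv_ofReal {u : Spc d → ℝ} (hu : Differentiable ℝ u) (x v : Spc d) :
    fderiv ℝ (fun y => ((u y : ℝ) : ℂ)) x v = ((fderiv ℝ u x v : ℝ) : ℂ) := by
  have := (Complex.ofRealCLM.hasFDerivAt (x := u x)).comp x (hu x).hasFDerivAt
  have e : fderiv ℝ (fun y => ((u y : ℝ) : ℂ)) x = Complex.ofRealCLM.comp (fderiv ℝ u x) :=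
    this.fderiv
  rw [e]; simp

lemma sup_bound (hd : d = 1 ∨ d = 2 ∨ d = 3) {u : Spc d → ℝ} (hu : Sm Ω u) (x : Spc d) :
    u x ^ 2 ≤ (∫ ξ : Spc d, ((1 + ‖ξ‖ ^ 2)⁻¹) ^ 2) * (2 * (∫ x, u x ^ 2) + 2 * L u) := by
  have hd4 : d < 4 := by omega
  let U : 𝓢(Spc d, ℂ) := HasCompactSupport.toSchwartzMap (f := fun y => ((u y : ℝ) : ℂ))
    (hu.hc.comp_left (g := fun r : ℝ => (r : ℂ)) (by simp))
    (Complex.ofRealCLM.contDiff.comp hu.cd)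
  have hU : ∀ y, U y = ((u y : ℝ) : ℂ) := fun y => rfl
  have hlap : ∀ y, (Δ U) y = ((lap u y : ℝ) : ℂ) := by
    intro y
    rw [laplacian_eq_sum (EuclideanSpace.basisFun (Fin d) ℝ)]
    rw [lap_eq, sum_apply]
    push_cast
    refine Finset.sum_congr rfl fun i _ => ?_
    have e1 : ∀ z, (∂_{(EuclideanSpace.basisFun (Fin d) ℝ) i} U) z = ((pd i u z : ℝ) : ℂ) := by
      intro z
      rw [lineDerivOp_apply_eq_fderiv]
      simp only [EuclideanSpace.basisFun_apply]
      exact fderiv_ofReal hu.diff z _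
    rw [lineDerivOp_apply_eq_fderiv]
    have e2 : (⇑((∂_{(EuclideanSpace.basisFun (Fin d) ℝ) i} U : 𝓢(Spc d, ℂ)))) = fun z => ((pd i u z : ℝ) : ℂ) :=
      funext e1
    rw [e2]
    simp only [EuclideanSpace.basisFun_apply]
    exact fderiv_ofReal (hu.px i).diff y _
  have hF : ∀ ξ, (𝓕 (Δ U)) ξ = ((-(2 * π) ^ 2 * ‖ξ‖ ^ 2 : ℝ) : ℂ) * (𝓕 U) ξ := by
    intro ξ
    rw [laplacian_eq_fourierMultiplierCLM, FourierTransform.fourier_smul, fourierMultiplierCLM_apply,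
      FourierTransform.fourier_fourierInv_eq, smul_apply,
      smulLeftCLM_apply_apply (by fun_prop)]
    simp
    ring
  have P0 : ∫ ξ, ‖(𝓕 U) ξ‖ ^ 2 = ∫ x, u x ^ 2 := by
    rw [integral_norm_sq_fourier]; simp [hU]
  have P2 : ∫ ξ, ‖(𝓕 (Δ U)) ξ‖ ^ 2 = L u := by
    rw [integral_norm_sq_fourier]; simp [hlap, L]
  have I0 : Integrable (fun ξ => ‖(𝓕 U) ξ‖ ^ 2) := ((𝓕 U).memLp 2).integrable_norm_pow (by simp)
  have I2 : Integrable (fun ξ => ‖(𝓕 (Δ U)) ξ‖ ^ 2) :=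
    ((𝓕 (Δ U)).memLp 2).integrable_norm_pow (by simp)
  have hpt : ∀ ξ, ((1 + ‖ξ‖ ^ 2) * ‖(𝓕 U) ξ‖) ^ 2
      ≤ 2 * ‖(𝓕 U) ξ‖ ^ 2 + 2 * ‖(𝓕 (Δ U)) ξ‖ ^ 2 := by
    intro ξ
    rw [hF, norm_mul, Complex.norm_real]
    have hpi : 1 ≤ (2 * π) ^ 2 := by nlinarith [Real.two_le_pi]
    have : ‖ξ‖ ^ 2 ≤ ‖-(2 * π) ^ 2 * ‖ξ‖ ^ 2‖ := by
      rw [norm_mul, norm_neg, Real.norm_of_nonneg (by positivity), norm_pow, norm_norm]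
      nlinarith [sq_nonneg ‖ξ‖]
    have h2 := mul_le_mul_of_nonneg_right this (norm_nonneg ((𝓕 U) ξ))
    have h3 := pow_le_pow_left₀ (by positivity) h2 2
    nlinarith [sq_nonneg (‖(𝓕 U) ξ‖ - ‖ξ‖ ^ 2 * ‖(𝓕 U) ξ‖)]
  have I3 : Integrable (fun ξ => ((1 + ‖ξ‖ ^ 2) * ‖(𝓕 U) ξ‖) ^ 2) := by
    refine ((I0.const_mul 2).add (I2.const_mul 2)).mono' ?_ (Filter.Eventually.of_forall fun ξ => ?_)
    · have := (𝓕 U).continuous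
      exact Continuous.aestronglyMeasurable (by fun_prop)
    · rw [Real.norm_of_nonneg (sq_nonneg _)]; exact hpt ξ
  have I4 : Integrable (fun ξ : Spc d => ((1 + ‖ξ‖ ^ 2)⁻¹) ^ 2) := by
    have := integrable_rpow_neg_one_add_norm_sq (E := Spc d) (μ := volume) (r := 4)
      (by simp; exact_mod_cast hd4)
    refine this.congr (Filter.Eventually.of_forall fun ξ => ?_)
    simp only
    rw [show (-4/2:ℝ) = -((2:ℕ):ℝ) by norm_num, Real.rpow_neg (by positivity), Real.rpow_natCast,
      inv_pow]
  have hsimp : ∀ ξ : Spc d, (1 + ‖ξ‖ ^ 2)⁻¹ * ((1 + ‖ξ‖ ^ 2) * ‖(𝓕 U) ξ‖) = ‖(𝓕 U) ξ‖ := by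
    intro ξ
    have : (1 + ‖ξ‖ ^ 2) ≠ 0 := by positivity
    field_simp
  have I1 : Integrable (fun ξ => ‖(𝓕 U) ξ‖) := (𝓕 U).integrable.norm
  have hcs := cs_gen I4 I3 (by simp_rw [hsimp]; exact I1)
  simp_rw [hsimp] at hcs
  have hinv : |u x| ≤ ∫ ξ, ‖(𝓕 U) ξ‖ := by
    have e : (𝓕⁻ (𝓕 U)) x = U x := by rw [FourierTransform.fourierInv_fourier_eq]
    have e2 : ‖U x‖ = |u x| := by rw [hU]; simp
    rw [← e2, ← e, fourierInv_apply_eq]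
    have := norm_fourier_apply_le_toLp_one (𝓕 U) (-x)
    rw [SchwartzMap.norm_toLp_one] at this
    simpa using this
  have hfin : ∫ ξ, ((1 + ‖ξ‖ ^ 2) * ‖(𝓕 U) ξ‖) ^ 2 ≤ 2 * (∫ x, u x ^ 2) + 2 * L u := by
    refine (integral_mono I3 ((I0.const_mul 2).add (I2.const_mul 2)) hpt).trans_eq ?_
    refine (integral_add (I0.const_mul 2) (I2.const_mul 2)).trans ?_
    rw [integral_const_mul, integral_const_mul,
      P0, P2]
  calc u x ^ 2 = |u x| ^ 2 := (sq_abs _).symm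
    _ ≤ (∫ ξ, ‖(𝓕 U) ξ‖) ^ 2 := pow_le_pow_left₀ (abs_nonneg _) hinv 2
    _ ≤ _ := hcs.trans (mul_le_mul_of_nonneg_left hfin (integral_nonneg fun ξ => sq_nonneg _))
end four

lemma sup_lap (hd : d = 1 ∨ d = 2 ∨ d = 3) (hop : IsOpen Ω) (hbd : Bornology.IsBounded Ω) :
    ∃ K : ℝ, 0 ≤ K ∧ ∀ w, Sm Ω w → ∀ x, w x ^ 2 ≤ K * L w := by
  obtain ⟨K1, hK1, h1⟩ := poinc hd hop hbd
  obtain ⟨K2, hK2, h2⟩ := grad_le_lap hd hop hbd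
  have hc : 0 ≤ (∫ ξ : Spc d, ((1 + ‖ξ‖ ^ 2)⁻¹) ^ 2) := integral_nonneg fun ξ => sq_nonneg _
  refine ⟨(∫ ξ : Spc d, ((1 + ‖ξ‖ ^ 2)⁻¹) ^ 2) * (2 * (K1 * K2) + 2), by positivity, fun w hw x => ?_⟩
  refine (sup_bound hd hw x).trans ?_
  rw [mul_assoc]
  refine mul_le_mul_of_nonneg_left ?_ hc
  have := (h1 w hw).trans (mul_le_mul_of_nonneg_left (h2 w hw) hK1)
  nlinarith

lemma hess_op (hg : Sm Ω g) (x : Spc d) :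
    ‖iteratedFDeriv ℝ 2 g x‖ ^ 2 ≤ ∑ i, ∑ j, pd j (pd i g) x ^ 2 := by
  have hd : DifferentiableAt ℝ (fderiv ℝ g) x :=
    (hg.cd.fderiv_right (m := (⊤ : ℕ∞)) (by simp)).differentiable (by simp) x
  have e : ∀ i j : Fin d, pd i (pd j g) x =
      fderiv ℝ (fderiv ℝ g) x (EuclideanSpace.single i 1) (EuclideanSpace.single j 1) := by
    intro i j
    unfold pd
    rw [fderiv_clm_apply hd (differentiableAt_const _)]
    simp
  have hv : ∀ v : Spc d, v = ∑ i, v i • EuclideanSpace.single i (1:ℝ) := by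
    intro v
    ext j
    simp [Pi.single_apply]
  have hexp : ∀ m : Fin 2 → Spc d, iteratedFDeriv ℝ 2 g x m =
      ∑ i, ∑ j, (m 1 i * m 0 j) * pd j (pd i g) x := by
    intro m
    rw [iteratedFDeriv_two_apply]
    conv_lhs => rw [hv (m 0), hv (m 1)]
    simp only [map_sum, sum_apply, map_smul, smul_apply,
      smul_eq_mul, e, Finset.mul_sum]
    exact Finset.sum_congr rfl fun i _ => Finset.sum_congr rfl fun j _ => by ring
  have hS : 0 ≤ ∑ i, ∑ j, pd j (pd i g) x ^ 2 :=
    Finset.sum_nonneg fun _ _ => Finset.sum_nonneg fun _ _ => sq_nonneg _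
  have : ‖iteratedFDeriv ℝ 2 g x‖ ≤ √(∑ i, ∑ j, pd j (pd i g) x ^ 2) := by
    refine ContinuousMultilinearMap.opNorm_le_bound (by positivity) fun m => ?_
    have hcs := Finset.sum_mul_sq_le_sq_mul_sq (Finset.univ : Finset (Fin d × Fin d))
      (fun p => m 1 p.1 * m 0 p.2) (fun p => pd p.2 (pd p.1 g) x)
    simp only [Fintype.sum_prod_type, mul_pow] at hcs
    rw [← Finset.sum_mul_sum] at hcs
    rw [hexp, Real.norm_eq_abs]
    refine abs_le_of_sq_le_sq (hcs.trans_eq ?_) (by positivity)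
    rw [mul_pow, Real.sq_sqrt hS, Fin.prod_univ_two, mul_pow, EuclideanSpace.norm_sq_eq,
      EuclideanSpace.norm_sq_eq]
    simp only [Real.norm_eq_abs, sq_abs]
    ring
  calc _ ≤ (√(∑ i, ∑ j, pd j (pd i g) x ^ 2)) ^ 2 := pow_le_pow_left₀ (norm_nonneg _) this 2
    _ = _ := Real.sq_sqrt hS

lemma lap_op (hg : Sm Ω g) (x : Spc d) :
    lap g x ^ 2 ≤ d ^ 2 * ‖iteratedFDeriv ℝ 2 g x‖ ^ 2 := by
  have hd : DifferentiableAt ℝ (fderiv ℝ g) x :=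
    (hg.cd.fderiv_right (m := (⊤ : ℕ∞)) (by simp)).differentiable (by simp) x
  have e : ∀ i : Fin d, |pd i (pd i g) x| ≤ ‖iteratedFDeriv ℝ 2 g x‖ := by
    intro i
    have h1 : pd i (pd i g) x = iteratedFDeriv ℝ 2 g x (fun _ => EuclideanSpace.single i 1) := by
      rw [iteratedFDeriv_two_apply]
      unfold pd
      rw [fderiv_clm_apply hd (differentiableAt_const _)]
      simp
    rw [h1]
    have := (iteratedFDeriv ℝ 2 g x).le_opNorm (fun _ => EuclideanSpace.single i 1)
    simpa using this
  have : |lap g x| ≤ d * ‖iteratedFDeriv ℝ 2 g x‖ := by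
    rw [lap_eq]
    refine (Finset.abs_sum_le_sum_abs _ _).trans ((Finset.sum_le_sum fun i _ => e i).trans_eq ?_)
    simp
  rw [← sq_abs, ← mul_pow]
  exact pow_le_pow_left₀ (abs_nonneg _) this 2

end

section

variable {Ω : Set (Spc d)} {g h : Spc d → ℝ}

lemma hess_int (hg : Sm Ω g) : Integrable (fun x => ‖iteratedFDeriv ℝ 2 g x‖ ^ 2) := by
  have hc : Continuous (fun x => iteratedFDeriv ℝ 2 g x) :=
    hg.cd.continuous_iteratedFDeriv (m := 2) (WithTop.coe_le_coe.2 (le_top : ((2:ℕ):ℕ∞) ≤ ⊤))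
  have hS : Sm Ω (fun x => ∑ i, ∑ j, pd j (pd i g) x ^ 2) :=
    Sm.sum _ fun i => Sm.sum _ fun j => ((hg.px i).px j).sq
  refine hS.int.mono' (hc.norm.pow 2).aestronglyMeasurable (Filter.Eventually.of_forall fun x => ?_)
  rw [Real.norm_of_nonneg (sq_nonneg _)]
  exact hess_op hg x

lemma sqHess_le (hg : Sm Ω g) : sqHess Ω g ≤ L g := by
  rw [← hess_eq hg]
  have hS : Sm Ω (fun x => ∑ i, ∑ j, pd j (pd i g) x ^ 2) :=
    Sm.sum _ fun i => Sm.sum _ fun j => ((hg.px i).px j).sq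
  have e : H g = ∫ x, ∑ i, ∑ j, pd j (pd i g) x ^ 2 := by
    rw [integral_finsetSum _ fun i _ => (Sm.sum _ fun j => ((hg.px i).px j).sq).int]
    refine Finset.sum_congr rfl fun i _ => ?_
    rw [integral_finsetSum _ fun j _ => ((hg.px i).px j).sq.int]
    rfl
  rw [e, ← hS.setInt]
  exact integral_mono (hess_int hg).integrableOn hS.int.integrableOn fun x => hess_op hg x

lemma lap_le_sqHess (hg : Sm Ω g) : L g ≤ d ^ 2 * sqHess Ω g := by
  unfold L sqHess
  rw [← hg.lp.sq.setInt, ← integral_const_mul]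
  exact integral_mono hg.lp.sq.int.integrableOn ((hess_int hg).integrableOn.const_mul _)
    fun x => lap_op hg x

lemma sqHess_nonneg (Ω : Set (Spc d)) (g : Spc d → ℝ) : 0 ≤ sqHess Ω g :=
  integral_nonneg fun x => sq_nonneg _

lemma Sm.grG (hg : Sm Ω g) : sqGrad Ω g = G g := hg.gr

lemma Sm.lapL (hg : Sm Ω g) : sqL2 Ω (lap g) = L g := hg.lp.l2

lemma sqH2_le (hd : d = 1 ∨ d = 2 ∨ d = 3) (hop : IsOpen Ω) (hbd : Bornology.IsBounded Ω) :
    ∃ K : ℝ, 0 ≤ K ∧ ∀ w, Sm Ω w → sqH2 Ω w ≤ K * L w := by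
  obtain ⟨K1, hK1, h1⟩ := poinc hd hop hbd
  obtain ⟨K2, hK2, h2⟩ := grad_le_lap hd hop hbd
  refine ⟨K1 * K2 + K2 + 1, by positivity, fun w hw => ?_⟩
  unfold sqH2
  rw [hw.l2, hw.grG]
  have a := sqHess_le hw
  have b := (h1 w hw).trans (mul_le_mul_of_nonneg_left (h2 w hw) hK1)
  have c := h2 w hw
  nlinarith

lemma lap_le_sqH2 (hg : Sm Ω g) : L g ≤ d ^ 2 * sqH2 Ω g := by
  refine (lap_le_sqHess hg).trans (mul_le_mul_of_nonneg_left ?_ (by positivity))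
  unfold sqH2
  rw [hg.l2, hg.grG]
  linarith [int_sq_nonneg g, G_nonneg g]

lemma G_le_sqH1 (hg : Sm Ω g) : G g ≤ sqH1 Ω g := by
  unfold sqH1
  rw [hg.l2, hg.grG]
  linarith [int_sq_nonneg g]

/-- the set defining the negative norm -/
def negSet (Ω : Set (Spc d)) (g : Spc d → ℝ) : Set ℝ :=
  { r : ℝ | ∃ φ : Spc d → ℝ, Sm Ω φ ∧ G φ ≤ 1 ∧ r = ∫ x, g x * φ x }

lemma negH1_eq (hg : Sm Ω g) : negH1 Ω g = sSup (negSet Ω g) := by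
  unfold negH1 negSet
  congr 1
  ext r
  constructor
  · rintro ⟨φ, h1, h2, h3, h4, h5⟩
    have hs : Sm Ω φ := ⟨h1, h2, h3⟩
    refine ⟨φ, hs, ?_, ?_⟩
    · rw [← hs.grG]; exact h4
    · rw [h5, (hg.mul hs).setInt]
  · rintro ⟨φ, hs, h4, h5⟩
    refine ⟨φ, hs.cd, hs.hc, hs.ts, ?_, ?_⟩
    · rw [← hs.grG] at h4; exact h4
    · rw [h5, (hg.mul hs).setInt]

lemma neg_bound {K : ℝ} (hK : 0 ≤ K) (hP : ∀ w, Sm Ω w → ∫ x, w x ^ 2 ≤ K * G w) (hg : Sm Ω g)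
    {r : ℝ} (hr : r ∈ negSet Ω g) : r ≤ √(K * ∫ x, g x ^ 2) := by
  obtain ⟨φ, hs, h4, rfl⟩ := hr
  apply Real.le_sqrt_of_sq_le
  refine (cs hg hs).trans ?_
  rw [mul_comm]
  refine mul_le_mul_of_nonneg_right ((hP φ hs).trans ?_) (int_sq_nonneg g)
  nlinarith

lemma neg_zero_mem (Ω : Set (Spc d)) (g : Spc d → ℝ) : (0:ℝ) ∈ negSet Ω g :=
  ⟨fun _ => 0, Sm.zero, by simp [G, pd], by simp⟩

lemma neg_bdd {K : ℝ} (hK : 0 ≤ K) (hP : ∀ w, Sm Ω w → ∫ x, w x ^ 2 ≤ K * G w) (hg : Sm Ω g) :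
    BddAbove (negSet Ω g) := ⟨_, fun _ hr => neg_bound hK hP hg hr⟩

lemma neg_lip {K : ℝ} (hK : 0 ≤ K) (hP : ∀ w, Sm Ω w → ∫ x, w x ^ 2 ≤ K * G w) (hg : Sm Ω g)
    (hh : Sm Ω h) : negH1 Ω g ≤ negH1 Ω h + √(K * ∫ x, (g x - h x) ^ 2) := by
  rw [negH1_eq hg, negH1_eq hh]
  refine csSup_le ⟨0, neg_zero_mem Ω g⟩ ?_
  rintro r ⟨φ, hs, h4, rfl⟩
  have e : ∫ x, g x * φ x = (∫ x, h x * φ x) + ∫ x, (g x - h x) * φ x := by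
    rw [← integral_add (hh.mul hs).int ((hg.sub hh).mul hs).int]
    congr 1; ext x; ring
  rw [e]
  exact add_le_add (le_csSup (neg_bdd hK hP hh) ⟨φ, hs, h4, rfl⟩)
    (neg_bound hK hP (hg.sub hh) ⟨φ, hs, h4, rfl⟩)

lemma G_smul (hg : Sm Ω g) (r : ℝ) : G (fun x => r * g x) = r ^ 2 * G g := by
  unfold G
  simp_rw [pd_smul hg, mul_pow, integral_const_mul, Finset.mul_sum]

lemma neg_nonneg' {K : ℝ} (hK : 0 ≤ K) (hP : ∀ w, Sm Ω w → ∫ x, w x ^ 2 ≤ K * G w) (hg : Sm Ω g) :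
    0 ≤ negH1 Ω g := by
  rw [negH1_eq hg]; exact le_csSup (neg_bdd hK hP hg) (neg_zero_mem Ω g)

lemma neg_dual {K : ℝ} (hK : 0 ≤ K) (hP : ∀ w, Sm Ω w → ∫ x, w x ^ 2 ≤ K * G w) (hg : Sm Ω g)
    (hh : Sm Ω h) : ∫ x, g x * h x ≤ negH1 Ω g * √(G h) := by
  rcases (G_nonneg h).eq_or_lt with h0 | h0
  · have h1 := hP h hh
    rw [← h0, mul_zero] at h1
    have h2 := cs hg hh
    rw [le_antisymm h1 (int_sq_nonneg h), mul_zero] at h2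
    rw [← h0, Real.sqrt_zero, mul_zero]
    nlinarith
  · have hs : 0 < √(G h) := Real.sqrt_pos.2 h0
    have hm : (∫ x, g x * ((√(G h))⁻¹ * h x)) ∈ negSet Ω g := by
      refine ⟨_, hh.smul _, ?_, rfl⟩
      rw [G_smul hh, inv_pow, Real.sq_sqrt h0.le]
      exact (inv_mul_cancel₀ h0.ne').le
    have h1 := le_csSup (neg_bdd hK hP hg) hm
    rw [← negH1_eq hg] at h1
    have e : ∫ x, g x * ((√(G h))⁻¹ * h x) = (√(G h))⁻¹ * ∫ x, g x * h x := by
      rw [← integral_const_mul]; congr 1; ext x; ring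
    rw [e] at h1
    rw [inv_mul_le_iff₀ hs] at h1
    linarith

end

section

variable {Ω : Set (Spc d)} {g h : Spc d → ℝ}
variable {w u : ℝ → Spc d → ℝ}

lemma Admissible.sm (hw : Admissible Ω w) (t : ℝ) : Sm Ω (w t) := by
  obtain ⟨h1, K, hK, hKO, hs⟩ := hw
  have hts : tsupport (w t) ⊆ K := closure_minimal (hs t) hK.isClosed
  refine ⟨h1.comp (contDiff_prodMk_right t), ?_, hts.trans hKO⟩
  exact hK.of_isClosed_subset (isClosed_tsupport _) hts

lemma Admissible.hdt (hw : Admissible Ω w) (t : ℝ) (x : Spc d) :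
    HasDerivAt (fun s => w s x)
      (fderiv ℝ (fun p : ℝ × Spc d => w p.1 p.2) (t, x) (1, 0)) t := by
  have h1 := (hw.1.differentiable (by simp) (t, x)).hasFDerivAt
  have h2 : HasDerivAt (fun s : ℝ => (s, x)) ((1:ℝ), (0 : Spc d)) t :=
    (hasDerivAt_id t).prodMk (hasDerivAt_const t x)
  exact h1.comp_hasDerivAt t h2

lemma Admissible.td_eq (hw : Admissible Ω w) (t : ℝ) (x : Spc d) :
    tderiv w t x = fderiv ℝ (fun p : ℝ × Spc d => w p.1 p.2) (t, x) (1, 0) :=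
  (hw.hdt t x).deriv

lemma Admissible.hd (hw : Admissible Ω w) (t : ℝ) (x : Spc d) :
    HasDerivAt (fun s => w s x) (tderiv w t x) t := by
  rw [hw.td_eq]; exact hw.hdt t x

lemma Admissible.pd_eq (hw : Admissible Ω w) (i : Fin d) (t : ℝ) (x : Spc d) :
    pd i (w t) x =
      fderiv ℝ (fun p : ℝ × Spc d => w p.1 p.2) (t, x) (0, EuclideanSpace.single i 1) := by
  have h1 := (hw.1.differentiable (by simp) (t, x)).hasFDerivAt
  have h2 : HasFDerivAt (fun y : Spc d => (t, y)) (ContinuousLinearMap.inr ℝ ℝ (Spc d)) x :=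
    hasFDerivAt_prodMk_right t x
  have h3 := (h1.comp x h2).fderiv
  unfold pd
  have e : (w t) = ((fun p : ℝ × Spc d => w p.1 p.2) ∘ fun y => (t, y)) := rfl
  rw [e, h3]; rfl

lemma Admissible.dir (hw : Admissible Ω w) (e : ℝ × Spc d) :
    ContDiff ℝ (⊤ : ℕ∞) (fun p => fderiv ℝ (fun p : ℝ × Spc d => w p.1 p.2) p e) :=
  (hw.1.fderiv_right (m := (⊤ : ℕ∞)) (by simp)).clm_apply contDiff_const

lemma Admissible.td (hw : Admissible Ω w) : Admissible Ω (tderiv w) := by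
  refine ⟨?_, ?_⟩
  · have e : (fun p : ℝ × Spc d => tderiv w p.1 p.2)
        = fun p => fderiv ℝ (fun p : ℝ × Spc d => w p.1 p.2) p (1, 0) := by
      ext p; exact hw.td_eq p.1 p.2
    rw [e]; exact hw.dir _
  · obtain ⟨h1, K, hK, hKO, hs⟩ := hw
    refine ⟨K, hK, hKO, fun t x hx => ?_⟩
    by_contra hxK
    apply hx
    have : (fun s => w s x) = fun _ => 0 := by
      ext s
      by_contra h0
      exact hxK (hs s h0)
    unfold tderiv
    rw [this]; simp

lemma Admissible.px (hw : Admissible Ω w) (i : Fin d) : Admissible Ω (fun t => pd i (w t)) := by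
  refine ⟨?_, ?_⟩
  · have e : (fun p : ℝ × Spc d => pd i (w p.1) p.2)
        = fun p => fderiv ℝ (fun p : ℝ × Spc d => w p.1 p.2) p
          (0, EuclideanSpace.single i 1) := by
      ext p; exact hw.pd_eq i p.1 p.2
    rw [e]; exact hw.dir _
  · obtain ⟨h1, K, hK, hKO, hs⟩ := hw
    refine ⟨K, hK, hKO, fun t => ?_⟩
    have hts : tsupport (w t) ⊆ K := closure_minimal (hs t) hK.isClosed
    exact (subset_tsupport _).trans
      ((tsupport_fderiv_apply_subset ℝ (EuclideanSpace.single i 1)).trans hts)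

lemma Admissible.comm (hw : Admissible Ω w) (i : Fin d) (t : ℝ) (x : Spc d) :
    tderiv (fun t => pd i (w t)) t x = pd i (tderiv w t) x := by
  rw [(hw.px i).td_eq, hw.td.pd_eq i]
  have e1 : (fun p : ℝ × Spc d => pd i (w p.1) p.2)
        = fun p => fderiv ℝ (fun p : ℝ × Spc d => w p.1 p.2) p
          (0, EuclideanSpace.single i 1) := by
      ext p; exact hw.pd_eq i p.1 p.2
  have e2 : (fun p : ℝ × Spc d => tderiv w p.1 p.2)
        = fun p => fderiv ℝ (fun p : ℝ × Spc d => w p.1 p.2) p (1, 0) := by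
      ext p; exact hw.td_eq p.1 p.2
  rw [e1, e2]
  have hd : DifferentiableAt ℝ (fderiv ℝ (fun p : ℝ × Spc d => w p.1 p.2)) (t, x) :=
    (hw.1.fderiv_right (m := (⊤ : ℕ∞)) (by simp)).differentiable (by simp) _
  have hsym : IsSymmSndFDerivAt ℝ (fun p : ℝ × Spc d => w p.1 p.2) (t, x) :=
    (hw.1.contDiffAt).isSymmSndFDerivAt (by
      simpa using (WithTop.coe_le_coe.2 (le_top : (2:ℕ∞) ≤ ⊤) : ((2:ℕ∞) : WithTop ℕ∞) ≤ _))
  have key : ∀ a b : ℝ × Spc d,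
      fderiv ℝ (fun p => fderiv ℝ (fun p : ℝ × Spc d => w p.1 p.2) p a) (t, x) b
       = fderiv ℝ (fderiv ℝ (fun p : ℝ × Spc d => w p.1 p.2)) (t, x) b a := by
    intro a b
    rw [fderiv_clm_apply hd (by fun_prop)]
    simp
  rw [key, key]
  exact hsym _ _

lemma Admissible.add (hw : Admissible Ω w) (hu : Admissible Ω u) :
    Admissible Ω (fun t x => w t x + u t x) := by
  obtain ⟨h1, K, hK, hKO, hs⟩ := hw
  obtain ⟨h1', K', hK', hKO', hs'⟩ := hu
  refine ⟨h1.add h1', K ∪ K', hK.union hK', Set.union_subset hKO hKO', fun t x hx => ?_⟩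
  by_contra hn
  rw [Set.mem_union, not_or] at hn
  have a : w t x = 0 := by
    by_contra h0; exact hn.1 (hs t h0)
  have b : u t x = 0 := by
    by_contra h0; exact hn.2 (hs' t h0)
  exact hx (by simp [a, b])

lemma Admissible.mul (hw : Admissible Ω w) (hu : Admissible Ω u) :
    Admissible Ω (fun t x => w t x * u t x) := by
  obtain ⟨h1, K, hK, hKO, hs⟩ := hw
  obtain ⟨h1', K', hK', hKO', hs'⟩ := hu
  refine ⟨h1.mul h1', K, hK, hKO, fun t x hx => ?_⟩
  by_contra hn
  have a : w t x = 0 := by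
    by_contra h0; exact hn (hs t h0)
  exact hx (by simp [a])

lemma Admissible.smul (hw : Admissible Ω w) (r : ℝ) :
    Admissible Ω (fun t x => r * w t x) := by
  obtain ⟨h1, K, hK, hKO, hs⟩ := hw
  refine ⟨contDiff_const.mul h1, K, hK, hKO, fun t x hx => ?_⟩
  by_contra hn
  have a : w t x = 0 := by
    by_contra h0; exact hn (hs t h0)
  exact hx (by simp [a])

lemma Admissible.sq (hw : Admissible Ω w) : Admissible Ω (fun t x => w t x ^ 2) := by
  simpa only [pow_two] using hw.mul hw

lemma Admissible.zero : Admissible Ω (fun _ _ => 0) :=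
  ⟨contDiff_const, ∅, isCompact_empty, Set.empty_subset _, fun t x hx => (hx rfl).elim⟩

lemma Admissible.sum {ι : Type*} (s : Finset ι) {W : ι → ℝ → Spc d → ℝ}
    (hW : ∀ i, Admissible Ω (W i)) : Admissible Ω (fun t x => ∑ i ∈ s, W i t x) := by
  classical
  induction s using Finset.induction_on with
  | empty => simpa using Admissible.zero
  | insert a s ha ih => simpa [Finset.sum_insert ha] using (hW a).add ih

lemma Admissible.lp (hw : Admissible Ω w) : Admissible Ω (fun t => lap (w t)) :=
  Admissible.sum Finset.univ fun i => (hw.px i).px i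

lemma Admissible.comm2 (hw : Admissible Ω w) (i j : Fin d) (t : ℝ) (x : Spc d) :
    tderiv (fun t => pd j (pd i (w t))) t x = pd j (pd i (tderiv w t)) x := by
  rw [(hw.px i).comm j]
  congr 1
  ext y
  exact hw.comm i t y

lemma Admissible.comm_lap (hw : Admissible Ω w) (t : ℝ) (x : Spc d) :
    tderiv (fun t => lap (w t)) t x = lap (tderiv w t) x := by
  unfold tderiv
  have : HasDerivAt (fun s => ∑ i, pd i (pd i (w s)) x)
      (∑ i, tderiv (fun t => pd i (pd i (w t))) t x) t :=
    HasDerivAt.fun_sum fun i _ => ((hw.px i).px i).hd t x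
  simp_rw [hw.comm2] at this
  exact this.deriv

lemma Admissible.hlap (hw : Admissible Ω w) (t : ℝ) (x : Spc d) :
    HasDerivAt (fun s => lap (w s) x) (lap (tderiv w t) x) t := by
  rw [← hw.comm_lap]; exact hw.lp.hd t x

lemma Admissible.hpd (hw : Admissible Ω w) (i : Fin d) (t : ℝ) (x : Spc d) :
    HasDerivAt (fun s => pd i (w s) x) (pd i (tderiv w t) x) t := by
  rw [← hw.comm]; exact (hw.px i).hd t x

lemma Admissible.bdd (hw : Admissible Ω w) (a b : ℝ) :
    ∃ K : Set (Spc d), IsCompact K ∧ ∃ C : ℝ, ∀ t ∈ Set.Icc a b, ∀ x,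
      |w t x| ≤ K.indicator (fun _ => C) x := by
  obtain ⟨h1, K, hK, hKO, hs⟩ := hw
  obtain ⟨C, hC⟩ := ((isCompact_Icc (a := a) (b := b)).prod hK).exists_bound_of_continuousOn
    h1.continuous.continuousOn
  refine ⟨K, hK, C, fun t ht x => ?_⟩
  by_cases hx : x ∈ K
  · rw [Set.indicator_of_mem hx]
    exact hC (t, x) ⟨ht, hx⟩
  · rw [Set.indicator_of_notMem hx]
    have : w t x = 0 := by
      by_contra h0; exact hx (hs t h0)
    simp [this]

lemma Admissible.hInt1 (hw : Admissible Ω w) (t : ℝ) :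
    HasDerivAt (fun t => ∫ x, w t x) (∫ x, tderiv w t x) t := by
  obtain ⟨K, hK, C, hC⟩ := hw.td.bdd (t - 1) (t + 1)
  refine (hasDerivAt_integral_of_dominated_loc_of_deriv_le (μ := volume)
    (F := fun t x => w t x) (F' := fun t x => tderiv w t x)
    (s := Set.Icc (t - 1) (t + 1)) (bound := K.indicator (fun _ => C))
    (Icc_mem_nhds (by linarith) (by linarith))
    (Filter.Eventually.of_forall fun s => (hw.sm s).cont.aestronglyMeasurable)
    (hw.sm t).int (hw.td.sm t).cont.aestronglyMeasurable
    (Filter.Eventually.of_forall fun x s hs => hC s hs x) ?_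
    (Filter.Eventually.of_forall fun x s hs => hw.hd s x)).2
  rw [integrable_indicator_iff hK.measurableSet]
  exact integrableOn_const hK.measure_lt_top.ne

lemma Admissible.cint (hw : Admissible Ω w) : Continuous (fun t => ∫ x, w t x) :=
  continuous_iff_continuousAt.2 fun t => (hw.hInt1 t).continuousAt

lemma Admissible.cG (hw : Admissible Ω w) : Continuous (fun t => G (w t)) :=
  continuous_finsetSum _ fun i _ => (hw.px i).sq.cint

lemma Admissible.cL (hw : Admissible Ω w) : Continuous (fun t => L (w t)) :=
  hw.lp.sq.cint

lemma Admissible.td_sq (hw : Admissible Ω w) (t : ℝ) (x : Spc d) :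
    tderiv (fun t x => w t x ^ 2) t x = 2 * (w t x * tderiv w t x) := by
  have := (hw.hd t x).pow 2
  refine this.deriv.trans ?_
  simp; ring

lemma Admissible.hsq (hw : Admissible Ω w) (t : ℝ) :
    HasDerivAt (fun t => ∫ x, w t x ^ 2) (2 * ∫ x, w t x * tderiv w t x) t := by
  have := hw.sq.hInt1 t
  simp_rw [hw.td_sq, integral_const_mul] at this
  exact this

lemma Admissible.hL (hw : Admissible Ω w) (t : ℝ) :
    HasDerivAt (fun t => L (w t)) (2 * ∫ x, lap (w t) x * lap (tderiv w t) x) t := by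
  have := hw.lp.hsq t
  simp_rw [hw.comm_lap] at this
  exact this

lemma Admissible.hG (hw : Admissible Ω w) (t : ℝ) :
    HasDerivAt (fun t => G (w t)) (-(2 * ∫ x, tderiv w t x * lap (w t) x)) t := by
  have : HasDerivAt (fun t => ∑ i, ∫ x, pd i (w t) x ^ 2)
      (∑ i, 2 * ∫ x, pd i (w t) x * pd i (tderiv w t) x) t := by
    refine HasDerivAt.fun_sum fun i _ => ?_
    have := (hw.px i).hsq t
    simp_rw [hw.comm] at this
    exact this
  have e : (∑ i, 2 * ∫ x, pd i (w t) x * pd i (tderiv w t) x)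
      = -(2 * ∫ x, tderiv w t x * lap (w t) x) := by
    rw [← Finset.mul_sum, ← mul_neg, ← green (hw.td.sm t) (hw.sm t)]
    congr 1
    refine Finset.sum_congr rfl fun i _ => ?_
    congr 1; ext x; ring
  rw [e] at this
  exact this

lemma Sm.adm (hg : Sm Ω g) : Admissible Ω (fun _ => g) :=
  ⟨hg.cd.comp contDiff_snd, tsupport g, hg.hc, hg.ts, fun _ => subset_tsupport _⟩

lemma neg_cont {K : ℝ} (hK : 0 ≤ K) (hP : ∀ w, Sm Ω w → ∫ x, w x ^ 2 ≤ K * G w)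
    (hw : Admissible Ω w) : Continuous (fun t => negH1 Ω (w t)) := by
  refine continuous_iff_continuousAt.2 fun t0 => ?_
  have hA : Admissible Ω (fun t x => (w t x + (-1) * w t0 x) ^ 2) :=
    (hw.add ((hw.sm t0).adm.smul (-1))).sq
  have hc : Continuous (fun t => √(K * ∫ x, (w t x - w t0 x) ^ 2)) := by
    have := hA.cint
    simp only [neg_mul, one_mul, ← sub_eq_add_neg] at this
    exact (continuous_const.mul this).sqrt
  have hl := hc.tendsto t0
  simp only [sub_self, ne_eq, OfNat.ofNat_ne_zero, not_false_eq_true, zero_pow, integral_zero,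
    mul_zero, Real.sqrt_zero] at hl
  refine tendsto_iff_dist_tendsto_zero.2 (squeeze_zero (fun _ => dist_nonneg) (fun t => ?_) hl)
  rw [Real.dist_eq, abs_sub_le_iff]
  constructor
  · have := neg_lip hK hP (hw.sm t) (hw.sm t0); linarith
  · have := neg_lip hK hP (hw.sm t0) (hw.sm t)
    have e : ∫ x, (w t0 x - w t x) ^ 2 = ∫ x, (w t x - w t0 x) ^ 2 := by
      congr 1; ext x; ring
    rw [e] at this; linarith

end

section

variable {Ω : Set (Spc d)} {g h : Spc d → ℝ}

lemma young {X s Y μ ε : ℝ} (hs : 0 ≤ s) (hY : 0 ≤ Y) (hε : 0 < ε) (h : X ^ 2 ≤ s * Y) :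
    μ * X ≤ ε * s + μ ^ 2 * Y / (4 * ε) := by
  have h1 : 0 ≤ ε * s + μ ^ 2 * Y / (4 * ε) := by positivity
  refine (abs_le_of_sq_le_sq' ?_ h1).2
  have h2 : (ε * s + μ ^ 2 * Y / (4 * ε)) ^ 2
      = (ε * s - μ ^ 2 * Y / (4 * ε)) ^ 2 + μ ^ 2 * (s * Y) := by
    field_simp; ring
  rw [h2]
  have : μ ^ 2 * X ^ 2 ≤ μ ^ 2 * (s * Y) := mul_le_mul_of_nonneg_left h (sq_nonneg _)
  nlinarith [sq_nonneg (ε * s - μ ^ 2 * Y / (4 * ε))]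

/-- lower order part -/
def Qf (c k σ : ℝ) (A P : Spc d → ℝ) (x : Spc d) : ℝ :=
  2 * k * c ^ 2 * (A x * lap P x) + 2 * σ * ∑ i, pd i P x * pd i A x

lemma Qf_sm (c k σ : ℝ) {A P : Spc d → ℝ} (hA : Sm Ω A) (hP : Sm Ω P) : Sm Ω (Qf c k σ A P) :=
  ((hA.mul hP.lp).smul _).add ((Sm.sum _ fun i => (hP.px i).mul (hA.px i)).smul _)

lemma Qf_bound (hd : d = 1 ∨ d = 2 ∨ d = 3) (hop : IsOpen Ω) (hbd : Bornology.IsBounded Ω)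
    (c k σ : ℝ) : ∃ K : ℝ, 0 ≤ K ∧ ∀ A P, Sm Ω A → Sm Ω P →
      ∫ x, Qf c k σ A P x ^ 2 ≤ K * (L A * L P) := by
  obtain ⟨K1, hK1, h1⟩ := sup_lap hd hop hbd
  obtain ⟨K2, hK2, h2⟩ := grad4 hd hop hbd
  refine ⟨2 * (2 * k * c ^ 2) ^ 2 * K1 + 2 * (2 * σ) ^ 2 * (d * (d * (K2 * K2))), by positivity,
    fun A P hA hP => ?_⟩
  have e1 : ∫ x, (A x * lap P x) ^ 2 ≤ K1 * L A * L P := by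
    unfold L
    rw [← integral_const_mul]
    refine integral_mono (hA.mul hP.lp).sq.int (hP.lp.sq.smul _).int fun x => ?_
    simp only [mul_pow]
    exact mul_le_mul_of_nonneg_right (h1 A hA x) (sq_nonneg _)
  have hS := Sm.sum (Ω := Ω) Finset.univ fun i => (hP.px i).mul (hA.px i)
  have hS2 := Sm.sum (Ω := Ω) Finset.univ fun i => ((hP.px i).mul (hA.px i)).sq
  have e2 : ∫ x, (∑ i, pd i P x * pd i A x) ^ 2 ≤ d * (d * (K2 * L P * (K2 * L A))) := by
    calc _ ≤ ∫ x, d * ∑ i, (pd i P x * pd i A x) ^ 2 := by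
          refine integral_mono hS.sq.int (hS2.smul _).int fun x => ?_
          have := sq_sum_le_card_mul_sum_sq (s := Finset.univ) (f := fun i => pd i P x * pd i A x)
          simpa using this
      _ = d * ∑ i, ∫ x, (pd i P x * pd i A x) ^ 2 := by
          rw [integral_const_mul, integral_finsetSum _ fun i _ => ((hP.px i).mul (hA.px i)).sq.int]
      _ ≤ d * ∑ i : Fin d, (K2 * L P * (K2 * L A)) := by
          refine mul_le_mul_of_nonneg_left (Finset.sum_le_sum fun i _ => ?_) (by positivity)
          exact l4_prod (mul_nonneg hK2 (L_nonneg P)) (mul_nonneg hK2 (L_nonneg A))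
            (hP.px i) (hA.px i) (h2 P hP i) (h2 A hA i)
      _ = _ := by simp
  have e3 : ∫ x, Qf c k σ A P x ^ 2 ≤ 2 * (2 * k * c ^ 2) ^ 2 * (∫ x, (A x * lap P x) ^ 2)
      + 2 * (2 * σ) ^ 2 * ∫ x, (∑ i, pd i P x * pd i A x) ^ 2 := by
    rw [← integral_const_mul, ← integral_const_mul,
      ← integral_add ((hA.mul hP.lp).sq.smul _).int (hS.sq.smul _).int]
    refine integral_mono (Qf_sm c k σ hA hP).sq.int
      (((hA.mul hP.lp).sq.smul _).add (hS.sq.smul _)).int fun x => ?_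
    simp only [Qf]
    nlinarith [sq_nonneg (2 * k * c ^ 2 * (A x * lap P x) - 2 * σ * ∑ i, pd i P x * pd i A x)]
  have e4 := mul_le_mul_of_nonneg_left e1 (by positivity : 0 ≤ 2 * (2 * k * c ^ 2) ^ 2)
  have e5 := mul_le_mul_of_nonneg_left e2 (by positivity : 0 ≤ 2 * (2 * σ) ^ 2)
  refine e3.trans ((add_le_add e4 e5).trans (le_of_eq ?_))
  ring

/-- first energy estimate at fixed time -/
lemma est1 {b c : ℝ} (hb : 0 < b) {P V W Q f : Spc d → ℝ} (hP : Sm Ω P) (hV : Sm Ω V)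
    (hW : Sm Ω W) (hQ : Sm Ω Q) (hf : Sm Ω f)
    (he : ∀ x, W x = b * lap V x + c ^ 2 * lap P x - Q x + f x) :
    -(2 * ∫ x, W x * lap V x) + c ^ 2 * (2 * ∫ x, lap P x * lap V x)
      ≤ 2 / b * (∫ x, Q x ^ 2) + 2 / b * (∫ x, f x ^ 2) - b * L V := by
  have e : -(2 * ∫ x, W x * lap V x) + c ^ 2 * (2 * ∫ x, lap P x * lap V x)
      = ∫ x, ((-2) * (W x * lap V x) + (c ^ 2 * 2) * (lap P x * lap V x)) := by
    rw [integral_add ((hW.mul hV.lp).smul _).int ((hP.lp.mul hV.lp).smul _).int,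
      integral_const_mul, integral_const_mul]
    ring
  have e2 : 2 / b * (∫ x, Q x ^ 2) + 2 / b * (∫ x, f x ^ 2) - b * L V
      = ∫ x, ((2 / b * Q x ^ 2 + 2 / b * f x ^ 2) - b * lap V x ^ 2) := by
    rw [integral_sub ((hQ.sq.smul _).add (hf.sq.smul _)).int (hV.lp.sq.smul _).int,
      integral_add (hQ.sq.smul _).int (hf.sq.smul _).int,
      integral_const_mul, integral_const_mul, integral_const_mul]
    rfl
  rw [e, e2]
  refine integral_mono (((hW.mul hV.lp).smul _).add ((hP.lp.mul hV.lp).smul _)).int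
    (((hQ.sq.smul _).add (hf.sq.smul _)).sub (hV.lp.sq.smul _)).int fun x => ?_
  simp only
  rw [he x]
  set y := lap V x
  set q := Q x
  set z := f x
  have h1 : (2 / b * q ^ 2 + 2 / b * z ^ 2) - b * y ^ 2
      - (-2 * ((b * y + c ^ 2 * lap P x - q + z) * y) + c ^ 2 * 2 * (lap P x * y))
      = (b * y - (q - z)) ^ 2 / b + (q + z) ^ 2 / b := by
    field_simp; ring
  have h2 : 0 ≤ (b * y - (q - z)) ^ 2 / b + (q + z) ^ 2 / b := by positivity
  linarith

lemma four_sq (a b c e : ℝ) : (a + b + c + e) ^ 2 ≤ 4 * (a ^ 2 + b ^ 2 + c ^ 2 + e ^ 2) := by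
  nlinarith [sq_nonneg (a - b), sq_nonneg (a - c), sq_nonneg (a - e), sq_nonneg (b - c),
    sq_nonneg (b - e), sq_nonneg (c - e)]

lemma int4 {x1 x2 x3 x4 y : Spc d → ℝ} (r1 r2 r3 r4 : ℝ) (h1 : Sm Ω x1) (h2 : Sm Ω x2)
    (h3 : Sm Ω x3) (h4 : Sm Ω x4) (hy : Sm Ω y)
    (he : ∀ x, y x = r1 * x1 x + r2 * x2 x + r3 * x3 x + r4 * x4 x) :
    ∫ x, y x ^ 2 ≤ 4 * (r1 ^ 2 * (∫ x, x1 x ^ 2) + r2 ^ 2 * (∫ x, x2 x ^ 2)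
      + r3 ^ 2 * (∫ x, x3 x ^ 2) + r4 ^ 2 * (∫ x, x4 x ^ 2)) := by
  rw [← integral_const_mul, ← integral_const_mul, ← integral_const_mul, ← integral_const_mul,
    ← integral_add (h1.sq.smul _).int (h2.sq.smul _).int,
    ← integral_add ((h1.sq.smul _).add (h2.sq.smul _)).int (h3.sq.smul _).int,
    ← integral_add (((h1.sq.smul _).add (h2.sq.smul _)).add (h3.sq.smul _)).int
      (h4.sq.smul _).int, ← integral_const_mul]
  refine integral_mono hy.sq.int (((((h1.sq.smul _).add (h2.sq.smul _)).add
    (h3.sq.smul _)).add (h4.sq.smul _)).smul _).int fun x => ?_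
  simp only
  rw [he x]
  refine (four_sq _ _ _ _).trans (le_of_eq ?_)
  ring

lemma est2 {b c : ℝ} {P V W Q f : Spc d → ℝ} (hP : Sm Ω P) (hV : Sm Ω V)
    (hW : Sm Ω W) (hQ : Sm Ω Q) (hf : Sm Ω f)
    (he : ∀ x, W x = b * lap V x + c ^ 2 * lap P x - Q x + f x) :
    ∫ x, W x ^ 2 ≤ 4 * (b ^ 2 * L V + (c ^ 2) ^ 2 * L P + (∫ x, Q x ^ 2) + ∫ x, f x ^ 2) := by
  have := int4 b (c ^ 2) (-1) 1 hV.lp hP.lp hQ hf hW (fun x => by rw [he x]; ring)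
  simpa [L] using this

lemma est4 {b c : ℝ} (hb : 0 < b) {P V W Q f : Spc d → ℝ} (hP : Sm Ω P) (hV : Sm Ω V)
    (hW : Sm Ω W) (hQ : Sm Ω Q) (hf : Sm Ω f)
    (he : ∀ x, W x = b * lap V x + c ^ 2 * lap P x - Q x + f x) :
    L V ≤ 4 * (b⁻¹ ^ 2 * (∫ x, W x ^ 2) + (c ^ 2 * b⁻¹) ^ 2 * L P + b⁻¹ ^ 2 * (∫ x, Q x ^ 2)
      + b⁻¹ ^ 2 * ∫ x, f x ^ 2) := by
  have := int4 b⁻¹ (-(c ^ 2 * b⁻¹)) b⁻¹ (-b⁻¹) hW hP.lp hQ hf hV.lp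
    (fun x => by rw [he x]; field_simp; ring)
  simpa [L] using this

lemma pd_le_G (hg : Sm Ω g) (i : Fin d) : ∫ x, pd i g x ^ 2 ≤ G g :=
  Finset.single_le_sum (f := fun i => ∫ x, pd i g x ^ 2) (fun i _ => int_sq_nonneg _)
    (Finset.mem_univ i)

/-- second energy estimate at fixed time -/
lemma est3 (hd : d = 1 ∨ d = 2 ∨ d = 3) (hop : IsOpen Ω) (hbd : Bornology.IsBounded Ω)
    {b : ℝ} (hb : 0 < b) (c k σ : ℝ) : ∃ K : ℝ, 0 ≤ K ∧ ∀ A A' P V W W' f', Sm Ω A → Sm Ω A' →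
      Sm Ω P → Sm Ω V → Sm Ω W → Sm Ω W' → Sm Ω f' →
      (∀ x, W' x = b * lap W x + c ^ 2 * lap V x
        - (2 * k * c ^ 2 * (A' x * lap P x + A x * lap V x)
          + 2 * σ * ∑ i, (pd i V x * pd i A x + pd i P x * pd i A' x)) + f' x) →
      2 * ∫ x, W x * W' x ≤ - b * G W + K * (G V + negH1 Ω f' ^ 2 + G A' * L P + G A * L V
        + L A * G V) := by
  obtain ⟨K1, hK1, h1⟩ := l4 hd hop hbd
  obtain ⟨K2, hK2, h2⟩ := grad4 hd hop hbd
  obtain ⟨K3, hK3, h3⟩ := poinc hd hop hbd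
  set ε : ℝ := b / (3 + 3 * d) with hε
  have hε0 : 0 < ε := by positivity
  set E : ℝ := 1 / (4 * ε) with hE
  have hE0 : 0 < E := by positivity
  refine ⟨d * ((2 * c ^ 2) ^ 2 * E) + 4 * E + (4 * k * c ^ 2) ^ 2 * (K1 * K1) * E
    + (4 * k * c ^ 2) ^ 2 * (K1 * K1) * E + d * ((4 * σ) ^ 2 * (K1 * K2) * E)
    + d * ((4 * σ) ^ 2 * (K1 * K2) * E), by positivity, ?_⟩
  intro A A' P V W W' f' hA hA' hP hV hW hW' hf' he
  have yg : ∀ {X Y : ℝ} (μ : ℝ), 0 ≤ Y → X ^ 2 ≤ G W * Y → μ * X ≤ ε * G W + μ ^ 2 * Y * E := by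
    intro X Y μ hY h
    have := young (μ := μ) (G_nonneg W) hY hε0 h
    rw [hE, mul_one_div]; exact this
  have t0 : ∀ i, (-(2 * c ^ 2)) * (∫ x, pd i W x * pd i V x)
      ≤ ε * G W + (-(2 * c ^ 2)) ^ 2 * G V * E := fun i =>
    yg _ (G_nonneg V) ((cs (hW.px i) (hV.px i)).trans
      (mul_le_mul (pd_le_G hW i) (pd_le_G hV i) (int_sq_nonneg _) (G_nonneg W)))
  have t1 : (-(4 * k * c ^ 2)) * (∫ x, lap P x * (W x * A' x))
      ≤ ε * G W + (-(4 * k * c ^ 2)) ^ 2 * (K1 * K1 * (G A' * L P)) * E := by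
    refine yg _ (by have := G_nonneg A'; have := L_nonneg P; positivity) ?_
    refine (tri (mul_nonneg hK1 (G_nonneg W)) (mul_nonneg hK1 (G_nonneg A')) hP.lp hW hA'
      (h1 W hW) (h1 A' hA')).trans (le_of_eq ?_)
    unfold L; ring
  have t2 : (-(4 * k * c ^ 2)) * (∫ x, lap V x * (W x * A x))
      ≤ ε * G W + (-(4 * k * c ^ 2)) ^ 2 * (K1 * K1 * (G A * L V)) * E := by
    refine yg _ (by have := G_nonneg A; have := L_nonneg V; positivity) ?_
    refine (tri (mul_nonneg hK1 (G_nonneg W)) (mul_nonneg hK1 (G_nonneg A)) hV.lp hW hA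
      (h1 W hW) (h1 A hA)).trans (le_of_eq ?_)
    unfold L; ring
  have t3 : ∀ i, (-(4 * σ)) * (∫ x, pd i V x * (W x * pd i A x))
      ≤ ε * G W + (-(4 * σ)) ^ 2 * (K1 * K2 * (L A * G V)) * E := fun i => by
    refine yg _ (by have := G_nonneg V; have := L_nonneg A; positivity) ?_
    refine (tri (mul_nonneg hK1 (G_nonneg W)) (mul_nonneg hK2 (L_nonneg A)) (hV.px i) hW (hA.px i)
      (h1 W hW) (h2 A hA i)).trans ?_
    refine (mul_le_mul_of_nonneg_right (pd_le_G hV i) ?_).trans (le_of_eq ?_)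
    · have := G_nonneg W; have := L_nonneg A; positivity
    · ring
  have t4 : ∀ i, (-(4 * σ)) * (∫ x, pd i A' x * (W x * pd i P x))
      ≤ ε * G W + (-(4 * σ)) ^ 2 * (K1 * K2 * (G A' * L P)) * E := fun i => by
    refine yg _ (by have := G_nonneg A'; have := L_nonneg P; positivity) ?_
    refine (tri (mul_nonneg hK1 (G_nonneg W)) (mul_nonneg hK2 (L_nonneg P)) (hA'.px i) hW (hP.px i)
      (h1 W hW) (h2 P hP i)).trans ?_
    refine (mul_le_mul_of_nonneg_right (pd_le_G hA' i) ?_).trans (le_of_eq ?_)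
    · have := G_nonneg W; have := L_nonneg P; positivity
    · ring
  have t5 : 2 * (∫ x, f' x * W x) ≤ ε * G W + 2 ^ 2 * negH1 Ω f' ^ 2 * E := by
    refine (mul_le_mul_of_nonneg_left (neg_dual hK3 h3 hf' hW) (by norm_num)).trans ?_
    refine yg _ (sq_nonneg _) (le_of_eq ?_)
    rw [mul_pow, Real.sq_sqrt (G_nonneg W)]; ring
  have t0' := Finset.sum_le_sum fun i (_ : i ∈ Finset.univ) => t0 i
  have t3' := Finset.sum_le_sum fun i (_ : i ∈ Finset.univ) => t3 i
  have t4' := Finset.sum_le_sum fun i (_ : i ∈ Finset.univ) => t4 i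
  rw [← Finset.mul_sum] at t0' t3' t4'
  simp only [Finset.sum_const, Finset.card_univ, Fintype.card_fin, nsmul_eq_mul] at t0' t3' t4'
  rw [green hW hV] at t0'
  have hG : G W = - ∫ x, W x * lap W x := by
    rw [← green hW hW]; unfold G
    refine Finset.sum_congr rfl fun i _ => ?_
    congr 1; ext x; ring
  have split : ∫ x, W x * W' x = b * (∫ x, W x * lap W x) + c ^ 2 * (∫ x, W x * lap V x)
      + (-(2 * k * c ^ 2)) * (∫ x, lap P x * (W x * A' x))
      + (-(2 * k * c ^ 2)) * (∫ x, lap V x * (W x * A x))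
      + (-(2 * σ)) * (∑ i, ∫ x, pd i V x * (W x * pd i A x))
      + (-(2 * σ)) * (∑ i, ∫ x, pd i A' x * (W x * pd i P x))
      + ∫ x, f' x * W x := by
    have s1 := (hW.mul hW.lp).smul b
    have s2 := (hW.mul hV.lp).smul (c ^ 2)
    have s3 := (hP.lp.mul (hW.mul hA')).smul (-(2 * k * c ^ 2))
    have s4 := (hV.lp.mul (hW.mul hA)).smul (-(2 * k * c ^ 2))
    have u5 := fun i => (hV.px i).mul (hW.mul (hA.px i))
    have u6 := fun i => (hA'.px i).mul (hW.mul (hP.px i))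
    have s5 := (Sm.sum Finset.univ u5).smul (-(2 * σ))
    have s6 := (Sm.sum Finset.univ u6).smul (-(2 * σ))
    have s7 := hf'.mul hW
    rw [← integral_finsetSum _ fun i _ => (u5 i).int, ← integral_finsetSum _ fun i _ => (u6 i).int,
      ← integral_const_mul, ← integral_const_mul, ← integral_const_mul, ← integral_const_mul,
      ← integral_const_mul, ← integral_const_mul,
      ← integral_add s1.int s2.int, ← integral_add (s1.add s2).int s3.int,
      ← integral_add ((s1.add s2).add s3).int s4.int,
      ← integral_add (((s1.add s2).add s3).add s4).int s5.int,
      ← integral_add ((((s1.add s2).add s3).add s4).add s5).int s6.int,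
      ← integral_add (((((s1.add s2).add s3).add s4).add s5).add s6).int s7.int]
    congr 1
    ext x
    rw [he x, Finset.sum_add_distrib]
    have a1 : ∑ i, pd i V x * (W x * pd i A x) = W x * ∑ i, pd i V x * pd i A x := by
      rw [Finset.mul_sum]; refine Finset.sum_congr rfl fun i _ => ?_; ring
    have a2 : ∑ i, pd i A' x * (W x * pd i P x) = W x * ∑ i, pd i P x * pd i A' x := by
      rw [Finset.mul_sum]; refine Finset.sum_congr rfl fun i _ => ?_; ring
    rw [a1, a2]; ring
  have hbe : b = (3 + 3 * d) * ε := by rw [hε]; field_simp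
  have hn1 := G_nonneg V
  have hn2 := mul_nonneg (G_nonneg A') (L_nonneg P)
  have hn3 := mul_nonneg (G_nonneg A) (L_nonneg V)
  have hn4 := mul_nonneg (L_nonneg A) (G_nonneg V)
  have hn5 := sq_nonneg (negH1 Ω f')
  have hk0 : 0 ≤ d * ((2 * c ^ 2) ^ 2 * E) := by positivity
  have hk1 : 0 ≤ (4 * k * c ^ 2) ^ 2 * (K1 * K1) * E := by positivity
  have hk2 : 0 ≤ d * ((4 * σ) ^ 2 * (K1 * K2) * E) := by positivity
  rw [split]
  have hbG : b * G W = (3 + 3 * d) * ε * G W := by rw [← hbe]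
  calc _ ≤ -2 * b * G W + (d * (ε * G W + (-(2 * c ^ 2)) ^ 2 * G V * E)
        + (ε * G W + (-(4 * k * c ^ 2)) ^ 2 * (K1 * K1 * (G A' * L P)) * E)
        + (ε * G W + (-(4 * k * c ^ 2)) ^ 2 * (K1 * K1 * (G A * L V)) * E)
        + d * (ε * G W + (-(4 * σ)) ^ 2 * (K1 * K2 * (L A * G V)) * E)
        + d * (ε * G W + (-(4 * σ)) ^ 2 * (K1 * K2 * (G A' * L P)) * E)
        + (ε * G W + 2 ^ 2 * negH1 Ω f' ^ 2 * E)) := by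
        rw [hG] at t0' t1 t2 t3' t4' t5 ⊢
        linarith
    _ = - b * G W + (d * ((2 * c ^ 2) ^ 2 * E) * G V
        + (4 * k * c ^ 2) ^ 2 * (K1 * K1) * E * (G A' * L P)
        + (4 * k * c ^ 2) ^ 2 * (K1 * K1) * E * (G A * L V)
        + d * ((4 * σ) ^ 2 * (K1 * K2) * E) * (L A * G V)
        + d * ((4 * σ) ^ 2 * (K1 * K2) * E) * (G A' * L P) + 4 * E * negH1 Ω f' ^ 2) := by
        have : -2 * b * G W = - b * G W - (3 + 3 * d) * ε * G W := by linarith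
        rw [this]; ring
    _ ≤ _ := by
        generalize d * ((2 * c ^ 2) ^ 2 * E) = k0 at *
        generalize (4 * k * c ^ 2) ^ 2 * (K1 * K1) * E = k1 at *
        generalize d * ((4 * σ) ^ 2 * (K1 * K2) * E) = k2 at *
        generalize G V = z1 at *
        generalize G A' * L P = z2 at *
        generalize G A * L V = z3 at *
        generalize L A * z1 = z4 at *
        generalize negH1 Ω f' ^ 2 = z5 at *
        have hh : 0 ≤ 4 * E := by positivity
        generalize 4 * E = k3 at *
        have := mul_nonneg hk0 hn2
        have := mul_nonneg hk0 hn3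
        have := mul_nonneg hk0 hn4
        have := mul_nonneg hk0 hn5
        have := mul_nonneg hk1 hn1
        have := mul_nonneg hk1 hn2
        have := mul_nonneg hk1 hn3
        have := mul_nonneg hk1 hn4
        have := mul_nonneg hk1 hn5
        have := mul_nonneg hk2 hn1
        have := mul_nonneg hk2 hn2
        have := mul_nonneg hk2 hn3
        have := mul_nonneg hk2 hn4
        have := mul_nonneg hk2 hn5
        have := mul_nonneg hh hn1
        have := mul_nonneg hh hn2
        have := mul_nonneg hh hn3
        have := mul_nonneg hh hn4
        have := mul_nonneg hh hn5
        linarith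

end

section

lemma hFI {g : ℝ → ℝ} (hg : Continuous g) (t : ℝ) :
    HasDerivAt (fun t => ∫ s in (0:ℝ)..t, g s) (g t) t :=
  intervalIntegral.integral_hasDerivAt_right (hg.intervalIntegrable _ _)
    hg.stronglyMeasurable.stronglyMeasurableAtFilter hg.continuousAt

lemma int_le_T {g : ℝ → ℝ} (hg : Continuous g) {T t : ℝ} (ht : t ∈ Set.Icc 0 T)
    (h0 : ∀ s, 0 ≤ s → 0 ≤ g s) : ∫ s in (0:ℝ)..t, g s ≤ ∫ s in (0:ℝ)..T, g s := by
  refine intervalIntegral.integral_mono_interval le_rfl ht.1 ht.2 ?_ (hg.intervalIntegrable _ _)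
  exact (ae_restrict_iff' measurableSet_Ioc).2 (Filter.Eventually.of_forall fun s hs => h0 s hs.1.le)

lemma int_nn {g : ℝ → ℝ} {t : ℝ} (ht : 0 ≤ t)
    (h0 : ∀ s, 0 ≤ s → 0 ≤ g s) : 0 ≤ ∫ s in (0:ℝ)..t, g s :=
  intervalIntegral.integral_nonneg ht fun s hs => h0 s hs.1

lemma int_mono {g h : ℝ → ℝ} (hg : Continuous g) (hh : Continuous h) {T : ℝ} (hT : 0 ≤ T)
    (hle : ∀ s ∈ Set.Icc 0 T, g s ≤ h s) : ∫ s in (0:ℝ)..T, g s ≤ ∫ s in (0:ℝ)..T, h s :=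
  intervalIntegral.integral_mono_on hT (hg.intervalIntegrable _ _) (hh.intervalIntegrable _ _) hle

lemma anti_le {Φ : ℝ → ℝ} {T : ℝ} (hc : Continuous Φ)
    (hD : ∀ t ∈ Set.Ioo 0 T, ∃ D, HasDerivAt Φ D t ∧ D ≤ 0) :
    ∀ t ∈ Set.Icc 0 T, Φ t ≤ Φ 0 := by
  have : AntitoneOn Φ (Set.Icc 0 T) := by
    refine antitoneOn_of_deriv_nonpos (convex_Icc 0 T) hc.continuousOn ?_ ?_
    · rw [interior_Icc]
      intro t ht
      obtain ⟨D, h1, _⟩ := hD t ht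
      exact h1.differentiableAt.differentiableWithinAt
    · rw [interior_Icc]
      intro t ht
      obtain ⟨D, h1, h2⟩ := hD t ht
      rw [h1.deriv]; exact h2
  intro t ht
  exact this ⟨le_rfl, ht.1.trans ht.2⟩ ht ht.1

lemma ode1 {b c2 K T B : ℝ} (hb : 0 < b) (hc2 : 0 < c2) (hK : 0 ≤ K)
    {a p q φ l : ℝ → ℝ} (ca : Continuous a) (cp : Continuous p) (cq : Continuous q)
    (cφ : Continuous φ) (cl : Continuous l) (a0 : ∀ t, 0 ≤ a t) (p0 : ∀ t, 0 ≤ p t) (q0 : ∀ t, 0 ≤ q t)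
    (φ0 : ∀ t, 0 ≤ φ t) (l0 : ∀ t, 0 ≤ l t)
    (h1 : ∀ t ∈ Set.Icc 0 T, ∃ D, HasDerivAt (fun t => a t + c2 * p t) D t ∧
      D ≤ K * φ t + K * (l t * p t) - b * q t)
    (hl : ∫ t in (0:ℝ)..T, l t ≤ B) :
    ∀ t ∈ Set.Icc 0 T, a t + c2 * p t + b * ∫ s in (0:ℝ)..t, q s ≤
      exp (K / c2 * B) * (a 0 + c2 * p 0 + K * ∫ s in (0:ℝ)..T, φ s) := by
  -- integrating factor
  set K' := K / c2 with hK'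
  have hK0 : 0 ≤ K' := by positivity
  have hKc : K' * c2 = K := by rw [hK']; field_simp
  set Hf : ℝ → ℝ := fun t => K' * ∫ s in (0:ℝ)..t, l s with hHf
  have dH : ∀ t, HasDerivAt Hf (K' * l t) t := fun t => (hFI cl t).const_mul K'
  have cH : Continuous Hf := continuous_iff_continuousAt.2 fun t => (dH t).continuousAt
  have cIφ : Continuous (fun t => ∫ s in (0:ℝ)..t, φ s) :=
    continuous_iff_continuousAt.2 fun t => (hFI cφ t).continuousAt
  have cIq : Continuous (fun t => ∫ s in (0:ℝ)..t, q s) :=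
    continuous_iff_continuousAt.2 fun t => (hFI cq t).continuousAt
  have hHB : ∀ t ∈ Set.Icc 0 T, Hf t ≤ K' * B := fun t ht =>
    mul_le_mul_of_nonneg_left ((int_le_T cl ht fun s _ => l0 s).trans hl) hK0
  have hH0 : ∀ t ∈ Set.Icc 0 T, 0 ≤ Hf t := fun t ht =>
    mul_nonneg hK0 (int_nn ht.1 fun s _ => l0 s)
  have key := anti_le (T := T) (Φ := fun t => exp (-Hf t) * (a t + c2 * p t)
      - K * (∫ s in (0:ℝ)..t, φ s) + b * exp (-(K' * B)) * ∫ s in (0:ℝ)..t, q s)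
    (by fun_prop) (by
      intro t ht
      have ht' : t ∈ Set.Icc 0 T := ⟨ht.1.le, ht.2.le⟩
      obtain ⟨D, hD, hle⟩ := h1 t ht'
      refine ⟨_, (((dH t).neg.exp.mul hD).sub ((hFI cφ t).const_mul K)).add
        ((hFI cq t).const_mul (b * exp (-(K' * B)))), ?_⟩
      have e1 : exp (-Hf t) ≤ 1 := exp_le_one_iff.2 (by linarith [hH0 t ht'])
      have e2 : exp (-(K' * B)) ≤ exp (-Hf t) := exp_le_exp.2 (by linarith [hHB t ht'])
      have e0 := exp_pos (-Hf t)
      set E := exp (-Hf t)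
      have m1 : E * D ≤ E * (K * φ t + K * (l t * p t) - b * q t) :=
        mul_le_mul_of_nonneg_left hle e0.le
      have m2 : 0 ≤ (1 - E) * (K * φ t) := mul_nonneg (by linarith) (mul_nonneg hK (φ0 t))
      have m3 : 0 ≤ (E - exp (-(K' * B))) * (b * q t) :=
        mul_nonneg (by linarith) (mul_nonneg hb.le (q0 t))
      have m4 : 0 ≤ E * (K' * l t * a t) :=
        mul_nonneg e0.le (mul_nonneg (mul_nonneg hK0 (l0 t)) (a0 t))
      have m5 : E * (K' * l t * (c2 * p t)) = E * (K * (l t * p t)) := by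
        rw [← hKc]; ring
      simp only [Pi.neg_apply]
      nlinarith)
  intro t ht
  have h := key t ht
  have z0 : Hf 0 = 0 := by simp [hHf]
  simp only [z0, neg_zero, exp_zero, one_mul, intervalIntegral.integral_same, mul_zero, sub_zero,
    add_zero] at h
  have hy : 0 ≤ exp (-Hf t) - exp (-(K' * B)) :=
    sub_nonneg.2 (exp_le_exp.2 (by linarith [hHB t ht]))
  have hφ := mul_le_mul_of_nonneg_left (int_le_T cφ ht fun s _ => φ0 s) hK
  have hs : 0 ≤ a t + c2 * p t := add_nonneg (a0 t) (mul_nonneg hc2.le (p0 t))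
  have h' : exp (-(K' * B)) * (a t + c2 * p t + b * ∫ s in (0:ℝ)..t, q s) ≤
      a 0 + c2 * p 0 + K * ∫ s in (0:ℝ)..T, φ s := by
    nlinarith [mul_nonneg hy hs]
  rw [exp_neg, inv_mul_le_iff₀ (exp_pos _)] at h'
  exact h'

set_option maxHeartbeats 1000000 in
/-- The full system of differential inequalities. -/
lemma ode2 {b c2 K T B : ℝ} (hb : 0 < b) (hc2 : 0 < c2) (hK : 0 ≤ K) (hT : 0 < T) (hB : 0 ≤ B) :
    ∃ C : ℝ, 0 < C ∧ ∀ a p q r s φ n l M N : ℝ → ℝ,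
      Continuous a → Continuous p → Continuous q → Continuous r → Continuous s →
      Continuous φ → Continuous n → Continuous l → Continuous M → Continuous N →
      (∀ t, 0 ≤ a t) → (∀ t, 0 ≤ p t) → (∀ t, 0 ≤ q t) → (∀ t, 0 ≤ r t) → (∀ t, 0 ≤ s t) →
      (∀ t, 0 ≤ φ t) → (∀ t, 0 ≤ n t) → (∀ t, 0 ≤ l t) → (∀ t, 0 ≤ M t) → (∀ t, 0 ≤ N t) →
      (∀ t ∈ Set.Icc 0 T, ∃ D, HasDerivAt (fun t => a t + c2 * p t) D t ∧
        D ≤ K * φ t + K * (l t * p t) - b * q t) →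
      (∀ t ∈ Set.Icc 0 T, r t ≤ K * (q t + p t + φ t + l t * p t)) →
      (∀ t ∈ Set.Ioo 0 T, ∃ D, HasDerivAt r D t ∧
        D ≤ - b * s t + K * (a t + n t + N t * p t + M t * q t + l t * a t)) →
      (∀ t ∈ Set.Icc 0 T, q t ≤ K * (r t + p t + φ t + l t * p t)) →
      (∫ t in (0:ℝ)..T, l t ≤ B) → (∀ t ∈ Set.Icc 0 T, M t ≤ B) →
      (∀ t ∈ Set.Icc 0 T, t * l t ≤ B) → (∫ t in (0:ℝ)..T, t * N t ≤ B) →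
      ∀ S : ℝ, (∀ t ∈ Set.Icc 0 T, t * φ t ≤ S) →
      ∀ Z : ℝ, Z = a 0 + p 0 + (∫ t in (0:ℝ)..T, φ t) + S + (∫ t in (0:ℝ)..T, t * n t) →
      (∀ t ∈ Set.Icc 0 T, a t ≤ C * Z ∧ p t ≤ C * Z ∧ t * r t ≤ C * Z ∧ t * q t ≤ C * Z) ∧
      (∫ t in (0:ℝ)..T, q t ≤ C * Z) ∧ (∫ t in (0:ℝ)..T, r t ≤ C * Z) ∧
      (∫ t in (0:ℝ)..T, t * s t ≤ C * Z) := by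
  set C0 : ℝ := exp (K / c2 * B) * (1 + c2 + K) with hC0
  have hC00 : 0 < C0 := by positivity
  set C1 : ℝ := C0 / c2 with hC1
  have hC10 : 0 < C1 := by positivity
  set C2 : ℝ := C0 / b with hC2
  have hC20 : 0 < C2 := by positivity
  set C3 : ℝ := K * (C2 + T * C1 + 1 + B * C1) with hC3
  have hC30 : 0 ≤ C3 := by positivity
  set C4 : ℝ := C3 + K * (T * T * C0 + 1 + B * C1 + T * B * C2 + T * B * C0) with hC4
  have hC40 : 0 ≤ C4 := by positivity
  set C5 : ℝ := K * (C4 + T * C1 + 1 + B * C1) with hC5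
  have hC50 : 0 ≤ C5 := by positivity
  refine ⟨C0 + C1 + C2 + C3 + C4 + C5 + C4 / b, by positivity, ?_⟩
  intro a p q r s φ n l M N ca cp cq cr cs cφ cn cl cM cN a0 p0 q0 r0 s0 φ0 n0 l0 M0 N0
    h1 h2 h3 h4 hl hM htl hN S hS Z hZ
  have iφ := int_nn (t := T) hT.le fun s _ => φ0 s
  have in0 := int_nn (g := fun t => t * n t) (t := T) hT.le fun s hs => mul_nonneg hs (n0 s)
  have hS0 : 0 ≤ S := by have := hS 0 ⟨le_rfl, hT.le⟩; simpa using this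
  have hZ0 : 0 ≤ Z := by rw [hZ]; linarith [a0 0, p0 0]
  have Y := ode1 hb hc2 hK ca cp cq cφ cl a0 p0 q0 φ0 l0 h1 hl
  have hY0 : exp (K / c2 * B) * (a 0 + c2 * p 0 + K * ∫ s in (0:ℝ)..T, φ s) ≤ C0 * Z := by
    rw [hC0, mul_assoc]
    refine mul_le_mul_of_nonneg_left ?_ (exp_pos _).le
    have z1 : a 0 ≤ Z := by rw [hZ]; linarith [a0 0, p0 0]
    have z2 : p 0 ≤ Z := by rw [hZ]; linarith [a0 0, p0 0]
    have z3 : (∫ s in (0:ℝ)..T, φ s) ≤ Z := by rw [hZ]; linarith [a0 0, p0 0]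
    nlinarith [mul_le_mul_of_nonneg_left z2 hc2.le, mul_le_mul_of_nonneg_left z3 hK]
  have zφ : (∫ s in (0:ℝ)..T, φ s) ≤ Z := by rw [hZ]; linarith [a0 0, p0 0]
  have zn : (∫ t in (0:ℝ)..T, t * n t) ≤ Z := by rw [hZ]; linarith [a0 0, p0 0]
  have zS : S ≤ Z := by rw [hZ]; linarith [a0 0, p0 0]
  have ba : ∀ t ∈ Set.Icc 0 T, a t ≤ C0 * Z := fun t ht => by
    have := (Y t ht).trans hY0
    have e1 := mul_nonneg hc2.le (p0 t)
    have e2 := mul_nonneg hb.le (int_nn ht.1 fun s _ => q0 s)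
    linarith
  have bp : ∀ t ∈ Set.Icc 0 T, p t ≤ C1 * Z := fun t ht => by
    have := (Y t ht).trans hY0
    have e2 := mul_nonneg hb.le (int_nn ht.1 fun s _ => q0 s)
    have e3 : c2 * p t ≤ C0 * Z := by linarith [a0 t]
    rw [hC1, div_mul_eq_mul_div, le_div_iff₀ hc2]; linarith
  have bq : ∫ t in (0:ℝ)..T, q t ≤ C2 * Z := by
    have := (Y T ⟨hT.le, le_rfl⟩).trans hY0
    have e1 := mul_nonneg hc2.le (p0 T)
    rw [hC2, div_mul_eq_mul_div, le_div_iff₀ hb]; linarith [a0 T]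
  have ii : ∀ {g : ℝ → ℝ}, Continuous g → IntervalIntegrable g volume 0 T :=
    fun hg => hg.intervalIntegrable _ _
  have br : ∫ t in (0:ℝ)..T, r t ≤ C3 * Z := by
    have e1 : ∫ t in (0:ℝ)..T, r t ≤
        ∫ t in (0:ℝ)..T, K * (q t + C1 * Z + φ t + l t * (C1 * Z)) := by
      refine int_mono cr (by fun_prop) hT.le fun t ht => (h2 t ht).trans ?_
      refine mul_le_mul_of_nonneg_left ?_ hK
      have := mul_le_mul_of_nonneg_left (bp t ht) (l0 t)
      linarith [bp t ht]
    rw [intervalIntegral.integral_const_mul,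
      intervalIntegral.integral_add (ii (by fun_prop)) (ii (by fun_prop)),
      intervalIntegral.integral_add (ii (by fun_prop)) (ii (by fun_prop)),
      intervalIntegral.integral_add (ii (by fun_prop)) (ii (by fun_prop)),
      intervalIntegral.integral_mul_const (C1 * Z) l, intervalIntegral.integral_const, smul_eq_mul,
      sub_zero] at e1
    refine e1.trans ?_
    rw [hC3, mul_assoc K]
    refine mul_le_mul_of_nonneg_left ?_ hK
    have := mul_le_mul_of_nonneg_right hl (mul_nonneg hC10.le hZ0)
    linarith
  -- weighted estimate
  set W : ℝ → ℝ := fun t => t * (a t + n t + N t * p t + M t * q t + l t * a t) with hW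
  have cW : Continuous W := by fun_prop
  have W0 : ∀ t, 0 ≤ t → 0 ≤ W t := fun t ht => by
    have := a0 t; have := n0 t; have := mul_nonneg (N0 t) (p0 t)
    have := mul_nonneg (M0 t) (q0 t); have := mul_nonneg (l0 t) (a0 t)
    exact mul_nonneg ht (by linarith)
  have cts : Continuous (fun t => t * s t) := by fun_prop
  have cI : ∀ {g : ℝ → ℝ}, Continuous g → Continuous (fun t => ∫ s in (0:ℝ)..t, g s) :=
    fun hg => continuous_iff_continuousAt.2 fun t => (hFI hg t).continuousAt
  have c1 := cI cr
  have c2' := cI cts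
  have c3 := cI cW
  have key := anti_le (T := T) (Φ := fun t => t * r t - (∫ s in (0:ℝ)..t, r s)
      + b * (∫ τ in (0:ℝ)..t, τ * s τ) - K * ∫ s in (0:ℝ)..t, W s) (by fun_prop) (by
      intro t ht
      obtain ⟨D, hD, hle⟩ := h3 t ht
      refine ⟨_, ((((hasDerivAt_id t).mul hD).sub (hFI cr t)).add ((hFI cts t).const_mul b)).sub
        ((hFI cW t).const_mul K), ?_⟩
      have := mul_le_mul_of_nonneg_left hle ht.1.le
      simp only [id, hW]
      nlinarith)
  have bW : ∫ t in (0:ℝ)..T, W t ≤ (T * T * C0 + 1 + B * C1 + T * B * C2 + T * B * C0) * Z := by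
    have e1 : ∫ t in (0:ℝ)..T, W t ≤ ∫ t in (0:ℝ)..T,
        (T * (C0 * Z) + t * n t + t * N t * (C1 * Z) + T * B * q t + B * (C0 * Z)) := by
      refine int_mono cW (by fun_prop) hT.le fun t ht => ?_
      have m1 : t * a t ≤ T * (C0 * Z) := mul_le_mul ht.2 (ba t ht) (a0 t) hT.le
      have m2 : t * N t * p t ≤ t * N t * (C1 * Z) :=
        mul_le_mul_of_nonneg_left (bp t ht) (mul_nonneg ht.1 (N0 t))
      have m3 : t * M t * q t ≤ T * B * q t :=
        mul_le_mul_of_nonneg_right (mul_le_mul ht.2 (hM t ht) (M0 t) hT.le) (q0 t)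
      have m4 : t * l t * a t ≤ B * (C0 * Z) := mul_le_mul (htl t ht) (ba t ht) (a0 t) hB
      simp only [hW]
      linarith
    rw [intervalIntegral.integral_add (ii (by fun_prop)) (ii (by fun_prop)),
      intervalIntegral.integral_add (ii (by fun_prop)) (ii (by fun_prop)),
      intervalIntegral.integral_add (ii (by fun_prop)) (ii (by fun_prop)),
      intervalIntegral.integral_add (ii (by fun_prop)) (ii (by fun_prop)),
      intervalIntegral.integral_mul_const (C1 * Z) (fun t => t * N t),
      intervalIntegral.integral_const_mul (T * B) q,
      intervalIntegral.integral_const, intervalIntegral.integral_const, smul_eq_mul, smul_eq_mul,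
      sub_zero] at e1
    have m5 := mul_le_mul_of_nonneg_right hN (mul_nonneg hC10.le hZ0)
    have m6 := mul_le_mul_of_nonneg_left bq (mul_nonneg hT.le hB)
    refine e1.trans ?_
    linarith
  have b4 : ∀ t ∈ Set.Icc 0 T, t * r t + b * (∫ τ in (0:ℝ)..t, τ * s τ) ≤ C4 * Z := by
    intro t ht
    have h := key t ht
    simp only [zero_mul, intervalIntegral.integral_same, mul_zero, sub_zero, add_zero] at h
    have m1 := int_le_T cr ht fun s _ => r0 s
    have m2 := mul_le_mul_of_nonneg_left ((int_le_T cW ht W0).trans bW) hK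
    rw [hC4]
    linarith
  have bts : ∀ t ∈ Set.Icc 0 T, 0 ≤ b * (∫ τ in (0:ℝ)..t, τ * s τ) := fun t ht =>
    mul_nonneg hb.le (int_nn ht.1 fun τ hτ => mul_nonneg hτ (s0 τ))
  have btr : ∀ t ∈ Set.Icc 0 T, t * r t ≤ C4 * Z := fun t ht => by
    linarith [b4 t ht, bts t ht]
  have bs : ∫ t in (0:ℝ)..T, t * s t ≤ C4 / b * Z := by
    have hTT : T ∈ Set.Icc 0 T := ⟨hT.le, le_rfl⟩
    have := b4 T hTT
    have := mul_nonneg hT.le (r0 T)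
    rw [div_mul_eq_mul_div, le_div_iff₀ hb]; linarith
  have btq : ∀ t ∈ Set.Icc 0 T, t * q t ≤ C5 * Z := fun t ht => by
    have m0 := mul_le_mul_of_nonneg_left (h4 t ht) ht.1
    refine m0.trans ?_
    have m1 : t * p t ≤ T * (C1 * Z) := mul_le_mul ht.2 (bp t ht) (p0 t) hT.le
    have m2 : t * l t * p t ≤ B * (C1 * Z) := mul_le_mul (htl t ht) (bp t ht) (p0 t) hB
    have m3 : t * r t + t * p t + t * φ t + t * l t * p t ≤ (C4 + T * C1 + 1 + B * C1) * Z := by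
      linarith [btr t ht, hS t ht]
    have m4 := mul_le_mul_of_nonneg_left m3 hK
    rw [hC5]; linarith
  have n0' := mul_nonneg hC00.le hZ0
  have n1' := mul_nonneg hC10.le hZ0
  have n2' := mul_nonneg hC20.le hZ0
  have n3' := mul_nonneg hC30 hZ0
  have n4' := mul_nonneg hC40 hZ0
  have n5' := mul_nonneg hC50 hZ0
  have n6' := mul_nonneg (div_nonneg hC40 hb.le) hZ0
  refine ⟨fun t ht => ⟨?_, ?_, ?_, ?_⟩, ?_, ?_, ?_⟩
  · linarith [ba t ht]
  · linarith [bp t ht]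
  · linarith [btr t ht]
  · linarith [btq t ht]
  · linarith
  · linarith
  · linarith

end

section

variable {Ω : Set (Spc d)} {g h : Spc d → ℝ}

lemma le_supIcc {T t : ℝ} {f : ℝ → ℝ} (hf : Continuous f) (ht : t ∈ Set.Icc 0 T) :
    f t ≤ supIcc T f := by
  have hb : BddAbove (Set.range fun t : Set.Icc (0:ℝ) T => f t) :=
    (isCompact_range (hf.comp continuous_subtype_val)).bddAbove
  exact le_ciSup hb ⟨t, ht⟩

lemma supIcc_le {T B : ℝ} (hT : 0 < T) {f : ℝ → ℝ} (h : ∀ t ∈ Set.Icc 0 T, f t ≤ B) :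
    supIcc T f ≤ B := by
  haveI : Nonempty (Set.Icc (0:ℝ) T) := ⟨⟨0, le_rfl, hT.le⟩⟩
  exact ciSup_le fun t => h t t.2

lemma supIcc_nonneg {T : ℝ} {f : ℝ → ℝ} (h : ∀ t, 0 ≤ f t) : 0 ≤ supIcc T f :=
  Real.iSup_nonneg fun t => h t

lemma eqn {b c k σ t : ℝ} {α ψ f : ℝ → Spc d → ℝ} (hα : Admissible Ω α) (hψ : Admissible Ω ψ)
    (hf : Admissible Ω f) (h : IsLinBlackstock Ω b c k σ α ψ f t) (x : Spc d) :
    tderiv (tderiv ψ) t x = b * lap (tderiv ψ t) x + c ^ 2 * lap (ψ t) x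
      - Qf c k σ (α t) (ψ t) x + f t x := by
  by_cases hx : x ∈ Ω
  · have := h x hx
    rw [gdot_eq] at this
    unfold Qf
    linarith
  · rw [(hψ.td.td.sm t).zero_off hx, (hψ.td.sm t).lp.zero_off hx, (hψ.sm t).lp.zero_off hx,
      (Qf_sm c k σ (hα.sm t) (hψ.sm t)).zero_off hx, (hf.sm t).zero_off hx]
    ring

lemma eqn' {b c k σ t T : ℝ} {α ψ f : ℝ → Spc d → ℝ} (hα : Admissible Ω α) (hψ : Admissible Ω ψ)
    (hf : Admissible Ω f) (h : ∀ t ∈ Set.Icc (0:ℝ) T, IsLinBlackstock Ω b c k σ α ψ f t)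
    (ht : t ∈ Set.Ioo 0 T) (x : Spc d) :
    tderiv (tderiv (tderiv ψ)) t x = b * lap (tderiv (tderiv ψ) t) x + c ^ 2 * lap (tderiv ψ t) x
        - (2 * k * c ^ 2 * (tderiv α t x * lap (ψ t) x + α t x * lap (tderiv ψ t) x)
          + 2 * σ * ∑ i, (pd i (tderiv ψ t) x * pd i (α t) x + pd i (ψ t) x * pd i (tderiv α t) x))
        + tderiv f t x := by
  have h1 : HasDerivAt (fun s => b * lap (tderiv ψ s) x + c ^ 2 * lap (ψ s) x
      - Qf c k σ (α s) (ψ s) x + f s x)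
      (b * lap (tderiv (tderiv ψ) t) x + c ^ 2 * lap (tderiv ψ t) x
        - (2 * k * c ^ 2 * (tderiv α t x * lap (ψ t) x + α t x * lap (tderiv ψ t) x)
          + 2 * σ * ∑ i, (pd i (tderiv ψ t) x * pd i (α t) x + pd i (ψ t) x * pd i (tderiv α t) x))
        + tderiv f t x) t := by
    refine (((((hψ.td.hlap t x).const_mul b).add ((hψ.hlap t x).const_mul (c ^ 2))).sub
      ((((hα.hd t x).mul (hψ.hlap t x)).const_mul (2 * k * c ^ 2)).add
        (HasDerivAt.const_mul (2 * σ) (HasDerivAt.fun_sum fun i _ => ?_))))).add (hf.hd t x)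
    exact (hψ.hpd i t x).mul (hα.hpd i t x)
  have h2 : HasDerivAt (fun s => tderiv (tderiv ψ) s x) _ t := hψ.td.td.hd t x
  refine h2.unique (h1.congr_of_eventuallyEq ?_)
  filter_upwards [Ioo_mem_nhds ht.1 ht.2] with s hs
  exact eqn hα hψ hf (h s ⟨hs.1.le, hs.2.le⟩) x

/-- bounds on the coefficient -/
lemma coef {T R : ℝ} (hT : 0 < T) (hR : 0 < R) {α : ℝ → Spc d → ℝ} (hα : Admissible Ω α)
    (h : normV Ω T α ≤ R) :
    (∫ t in (0:ℝ)..T, L (α t) ≤ R ^ 2) ∧ (∀ t ∈ Set.Icc 0 T, G (α t) ≤ R ^ 2) ∧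
      (∀ t ∈ Set.Icc 0 T, t * L (α t) ≤ R ^ 2) ∧ (∫ t in (0:ℝ)..T, t * G (tderiv α t) ≤ R ^ 2) := by
  have n1 : 0 ≤ supIcc T (fun t => Real.sqrt (sqH1 Ω (α t))) := supIcc_nonneg fun t => sqrt_nonneg _
  have n2 : 0 ≤ supIcc T (fun t => Real.sqrt t * Real.sqrt (sqL2 Ω (tderiv α t))) :=
    supIcc_nonneg fun t => mul_nonneg (sqrt_nonneg _) (sqrt_nonneg _)
  have n3 : 0 ≤ supIcc T (fun t => Real.sqrt t * Real.sqrt (sqL2 Ω (lap (α t)))) :=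
    supIcc_nonneg fun t => mul_nonneg (sqrt_nonneg _) (sqrt_nonneg _)
  unfold normV at h
  have n4 := sqrt_nonneg (∫ t in (0:ℝ)..T, (sqL2 Ω (α t) + sqGrad Ω (α t) + sqL2 Ω (lap (α t))))
  have n5 := sqrt_nonneg (∫ t in (0:ℝ)..T, sqL2 Ω (tderiv α t))
  have n6 := sqrt_nonneg (∫ t in (0:ℝ)..T, t * sqGrad Ω (tderiv α t))
  have e1 : (fun t => sqH1 Ω (α t)) = fun t => (∫ x, α t x ^ 2) + G (α t) := by
    ext t; unfold sqH1; rw [(hα.sm t).l2, (hα.sm t).grG]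
  have e2 : (fun t => sqL2 Ω (lap (α t))) = fun t => L (α t) := by
    ext t; exact (hα.sm t).lapL
  have e3 : (fun t => sqL2 Ω (α t) + sqGrad Ω (α t) + sqL2 Ω (lap (α t)))
      = fun t => (∫ x, α t x ^ 2) + G (α t) + L (α t) := by
    ext t; rw [(hα.sm t).l2, (hα.sm t).grG, (hα.sm t).lapL]
  have e4 : (fun t => t * sqGrad Ω (tderiv α t)) = fun t => t * G (tderiv α t) := by
    ext t; rw [(hα.td.sm t).grG]
  have cA := hα.sq.cint
  have cG := hα.cG
  have cL := hα.cL
  refine ⟨?_, fun t ht => ?_, fun t ht => ?_, ?_⟩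
  · have s : √(∫ t in (0:ℝ)..T, (sqL2 Ω (α t) + sqGrad Ω (α t) + sqL2 Ω (lap (α t)))) ≤ R := by
      linarith
    rw [e3, Real.sqrt_le_left hR.le] at s
    refine le_trans (int_mono cL (by fun_prop) hT.le fun t _ => ?_) s
    linarith [int_sq_nonneg (α t), G_nonneg (α t)]
  · have c : Continuous (fun t => √(sqH1 Ω (α t))) := by
      have : Continuous (fun t => sqH1 Ω (α t)) := by rw [e1]; fun_prop
      exact this.sqrt
    have s : √(sqH1 Ω (α t)) ≤ R := by
      have := le_supIcc c ht
      linarith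
    rw [Real.sqrt_le_left hR.le] at s
    exact (G_le_sqH1 (hα.sm t)).trans s
  · have c : Continuous (fun t => √t * √(sqL2 Ω (lap (α t)))) := by
      have : Continuous (fun t => sqL2 Ω (lap (α t))) := by rw [e2]; exact cL
      exact Real.continuous_sqrt.mul this.sqrt
    have s : √t * √(sqL2 Ω (lap (α t))) ≤ R := by
      have := le_supIcc c ht
      linarith
    rw [← Real.sqrt_mul ht.1, Real.sqrt_le_left hR.le, (hα.sm t).lapL] at s
    exact s
  · have s : √(∫ t in (0:ℝ)..T, t * sqGrad Ω (tderiv α t)) ≤ R := by linarith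
    rw [e4, Real.sqrt_le_left hR.le] at s
    exact s

/-- all estimates in terms of squared quantities -/
lemma main_est (hd : d = 1 ∨ d = 2 ∨ d = 3) (hop : IsOpen Ω) (hbd : Bornology.IsBounded Ω)
    (b c k σ : ℝ) (hb : 0 < b) (hc : 0 < c) (T R : ℝ) (hT : 0 < T) (hR : 0 < R) :
    ∃ C : ℝ, 0 < C ∧ ∀ α ψ f : ℝ → Spc d → ℝ,
      Admissible Ω α → Admissible Ω ψ → Admissible Ω f → normV Ω T α ≤ R →
      (∀ t ∈ Set.Icc (0:ℝ) T, IsLinBlackstock Ω b c k σ α ψ f t) →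
      ∀ S : ℝ, (∀ t ∈ Set.Icc 0 T, t * (∫ x, f t x ^ 2) ≤ S) →
      ∀ Z : ℝ, Z = G (tderiv ψ 0) + L (ψ 0) + (∫ t in (0:ℝ)..T, ∫ x, f t x ^ 2) + S
        + (∫ t in (0:ℝ)..T, t * negH1 Ω (tderiv f t) ^ 2) →
      (∀ t ∈ Set.Icc 0 T, G (tderiv ψ t) ≤ C * Z ∧ L (ψ t) ≤ C * Z ∧
        t * (∫ x, tderiv (tderiv ψ) t x ^ 2) ≤ C * Z ∧ t * L (tderiv ψ t) ≤ C * Z) ∧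
      (∫ t in (0:ℝ)..T, L (tderiv ψ t) ≤ C * Z) ∧
      (∫ t in (0:ℝ)..T, ∫ x, tderiv (tderiv ψ) t x ^ 2 ≤ C * Z) ∧
      (∫ t in (0:ℝ)..T, t * G (tderiv (tderiv ψ) t) ≤ C * Z) := by
  obtain ⟨K1, hK1, h1⟩ := Qf_bound hd hop hbd c k σ
  obtain ⟨K3, hK3, h3⟩ := est3 hd hop hbd hb c k σ
  obtain ⟨Kp, hKp, hp⟩ := poinc hd hop hbd
  have hbi : 0 < b⁻¹ := by positivity
  set k1 := 2 / b with hk1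
  have k10 : 0 < k1 := by positivity
  set k2 := 2 / b * K1 with hk2
  have k20 : 0 ≤ k2 := by positivity
  set k3 := 4 * b ^ 2 + 4 * (c ^ 2) ^ 2 + 4 * K1 + 4 with hk3
  have k30 : 0 ≤ k3 := by positivity
  set k4 := 4 * b⁻¹ ^ 2 + 4 * (c ^ 2 * b⁻¹) ^ 2 + 4 * (b⁻¹ ^ 2 * K1) with hk4
  have k40 : 0 ≤ k4 := by positivity
  obtain ⟨C, hC, hode⟩ := ode2 (b := b) (c2 := c ^ 2) (K := k1 + k2 + k3 + k4 + K3) (T := T)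
    (B := R ^ 2) hb (by positivity) (by positivity) hT (by positivity)
  refine ⟨C, hC, fun α ψ f hα hψ hf hn heq => ?_⟩
  obtain ⟨g1, g2, g3, g4⟩ := coef hT hR hα hn
  have hv := hψ.td
  have hw := hψ.td.td
  refine hode (fun t => G (tderiv ψ t)) (fun t => L (ψ t)) (fun t => L (tderiv ψ t))
    (fun t => ∫ x, tderiv (tderiv ψ) t x ^ 2) (fun t => G (tderiv (tderiv ψ) t))
    (fun t => ∫ x, f t x ^ 2) (fun t => negH1 Ω (tderiv f t) ^ 2) (fun t => L (α t))
    (fun t => G (α t)) (fun t => G (tderiv α t)) hv.cG hψ.cL hv.cL hw.sq.cint hw.cG hf.sq.cint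
    ((neg_cont hKp hp hf.td).pow 2) hα.cL hα.cG hα.td.cG
    (fun t => G_nonneg _) (fun t => L_nonneg _) (fun t => L_nonneg _) (fun t => int_sq_nonneg _)
    (fun t => G_nonneg _) (fun t => int_sq_nonneg _) (fun t => sq_nonneg _) (fun t => L_nonneg _)
    (fun t => G_nonneg _) (fun t => G_nonneg _) ?_ ?_ ?_ ?_ g1 g2 g3 g4
  · intro t ht
    refine ⟨_, (hv.hG t).add ((hψ.hL t).const_mul (c ^ 2)), ?_⟩
    have hQ := Qf_sm c k σ (hα.sm t) (hψ.sm t)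
    refine (est1 hb (hψ.sm t) (hv.sm t) (hw.sm t) hQ (hf.sm t)
      (eqn hα hψ hf (heq t ht))).trans ?_
    have m1 := mul_le_mul_of_nonneg_left (h1 _ _ (hα.sm t) (hψ.sm t)) k10.le
    have z1 := int_sq_nonneg (f t)
    have z2 := mul_nonneg (L_nonneg (α t)) (L_nonneg (ψ t))
    have e : k1 * (K1 * (L (α t) * L (ψ t))) = k2 * (L (α t) * L (ψ t)) := by rw [hk2]; ring
    rw [e] at m1
    have := mul_nonneg k20 z1
    have := mul_nonneg k30 z1
    have := mul_nonneg k40 z1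
    have := mul_nonneg hK3 z1
    have := mul_nonneg k10.le z2
    have := mul_nonneg k30 z2
    have := mul_nonneg k40 z2
    have := mul_nonneg hK3 z2
    linarith
  · intro t ht
    have hQ := Qf_sm c k σ (hα.sm t) (hψ.sm t)
    refine (est2 (hψ.sm t) (hv.sm t) (hw.sm t) hQ (hf.sm t)
      (eqn hα hψ hf (heq t ht))).trans ?_
    have m1 := h1 _ _ (hα.sm t) (hψ.sm t)
    have z1 := int_sq_nonneg (f t)
    have z2 := mul_nonneg (L_nonneg (α t)) (L_nonneg (ψ t))
    have z3 := L_nonneg (tderiv ψ t)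
    have z4 := L_nonneg (ψ t)
    have z : 0 ≤ L (tderiv ψ t) + L (ψ t) + (∫ x, f t x ^ 2) + L (α t) * L (ψ t) := by linarith
    have m2 : 4 * (b ^ 2 * L (tderiv ψ t) + (c ^ 2) ^ 2 * L (ψ t) + K1 * (L (α t) * L (ψ t))
        + ∫ x, f t x ^ 2) ≤ k3 * (L (tderiv ψ t) + L (ψ t) + (∫ x, f t x ^ 2)
          + L (α t) * L (ψ t)) := by
      have y1 : 0 ≤ b ^ 2 := by positivity
      have y2 : 0 ≤ (c ^ 2) ^ 2 := by positivity
      rw [hk3]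
      generalize b ^ 2 = x1 at *
      generalize (c ^ 2) ^ 2 = x2 at *
      generalize L (α t) * L (ψ t) = w2 at *
      generalize L (tderiv ψ t) = w3 at *
      generalize L (ψ t) = w4 at *
      generalize (∫ x, f t x ^ 2) = w1 at *
      have := mul_nonneg y1 z1
      have := mul_nonneg y1 z2
      have := mul_nonneg y1 z4
      have := mul_nonneg y2 z1
      have := mul_nonneg y2 z2
      have := mul_nonneg y2 z3
      have := mul_nonneg hK1 z1
      have := mul_nonneg hK1 z3
      have := mul_nonneg hK1 z4
      linarith
    have m3 : k3 * (L (tderiv ψ t) + L (ψ t) + (∫ x, f t x ^ 2) + L (α t) * L (ψ t)) ≤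
        (k1 + k2 + k3 + k4 + K3) * (L (tderiv ψ t) + L (ψ t) + (∫ x, f t x ^ 2)
          + L (α t) * L (ψ t)) := mul_le_mul_of_nonneg_right (by linarith) z
    refine le_trans ?_ (m2.trans m3)
    linarith
  · intro t ht
    refine ⟨_, hw.hsq t, ?_⟩
    refine (h3 _ _ _ _ _ _ _ (hα.sm t) (hα.td.sm t) (hψ.sm t) (hv.sm t) (hw.sm t) (hw.td.sm t)
      (hf.td.sm t) (eqn' hα hψ hf heq ht)).trans ?_
    refine add_le_add le_rfl (mul_le_mul_of_nonneg_right (by linarith) ?_)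
    have := G_nonneg (tderiv ψ t)
    have := sq_nonneg (negH1 Ω (tderiv f t))
    have := mul_nonneg (G_nonneg (tderiv α t)) (L_nonneg (ψ t))
    have := mul_nonneg (G_nonneg (α t)) (L_nonneg (tderiv ψ t))
    have := mul_nonneg (L_nonneg (α t)) (G_nonneg (tderiv ψ t))
    linarith
  · intro t ht
    have hQ := Qf_sm c k σ (hα.sm t) (hψ.sm t)
    refine (est4 hb (hψ.sm t) (hv.sm t) (hw.sm t) hQ (hf.sm t)
      (eqn hα hψ hf (heq t ht))).trans ?_
    have y1 : 0 ≤ b⁻¹ ^ 2 := by positivity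
    have y2 : 0 ≤ (c ^ 2 * b⁻¹) ^ 2 := by positivity
    have m1 := mul_le_mul_of_nonneg_left (h1 _ _ (hα.sm t) (hψ.sm t)) y1
    have z1 := int_sq_nonneg (f t)
    have z2 := mul_nonneg (L_nonneg (α t)) (L_nonneg (ψ t))
    have z3 := int_sq_nonneg (tderiv (tderiv ψ) t)
    have z4 := L_nonneg (ψ t)
    have z : 0 ≤ (∫ x, tderiv (tderiv ψ) t x ^ 2) + L (ψ t) + (∫ x, f t x ^ 2)
      + L (α t) * L (ψ t) := by linarith
    have m3 : k4 * ((∫ x, tderiv (tderiv ψ) t x ^ 2) + L (ψ t) + (∫ x, f t x ^ 2)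
          + L (α t) * L (ψ t)) ≤
        (k1 + k2 + k3 + k4 + K3) * ((∫ x, tderiv (tderiv ψ) t x ^ 2) + L (ψ t)
          + (∫ x, f t x ^ 2) + L (α t) * L (ψ t)) :=
      mul_le_mul_of_nonneg_right (by linarith) z
    refine le_trans ?_ m3
    rw [hk4]
    clear m3 z
    have y3 := mul_nonneg y1 hK1
    rw [← mul_assoc] at m1
    generalize b⁻¹ ^ 2 * K1 = x3 at *
    generalize b⁻¹ ^ 2 = x1 at *
    generalize (c ^ 2 * b⁻¹) ^ 2 = x2 at *
    generalize L (α t) * L (ψ t) = w2 at *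
    generalize (∫ x, tderiv (tderiv ψ) t x ^ 2) = w3 at *
    generalize L (ψ t) = w4 at *
    generalize (∫ x, f t x ^ 2) = w1 at *
    have := mul_nonneg y1 z2
    have := mul_nonneg y1 z4
    have := mul_nonneg y2 z1
    have := mul_nonneg y2 z2
    have := mul_nonneg y2 z3
    have := mul_nonneg y3 z1
    have := mul_nonneg y3 z3
    have := mul_nonneg y3 z4
    linarith

end

section

set_option maxHeartbeats 2000000 in
/-- a priori estimate for the linearized Blackstock equation
under a smallness assumption on the variable coefficient. -/
theorem final_estimate (d : ℕ) (hd : d = 1 ∨ d = 2 ∨ d = 3)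
    (Ω : Set (Spc d)) (hne : Ω.Nonempty) (hop : IsOpen Ω) (hbd : Bornology.IsBounded Ω)
    (b c k σ : ℝ) (hb : 0 < b) (hc : 0 < c) (T R : ℝ) (hT : 0 < T) (hR : 0 < R) :
    ∃ m > (0:ℝ), ∃ C > (0:ℝ),
      ∀ α ψ f : ℝ → Spc d → ℝ,
        Admissible Ω α → Admissible Ω ψ → Admissible Ω f →
        normV Ω T α ≤ R →
        |k| * (supIcc T (fun t => Real.sqrt (sqL2 Ω (α t)))
            + Real.sqrt (∫ t in (0:ℝ)..T, t * sqL2 Ω (tderiv α t)))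
          + |σ| * (Real.sqrt (∫ t in (0:ℝ)..T, sqGrad Ω (α t))
            + Real.sqrt (∫ t in (0:ℝ)..T, t * sqGrad Ω (tderiv α t))) ≤ m →
        (∀ t ∈ Set.Icc (0:ℝ) T, IsLinBlackstock Ω b c k σ α ψ f t) →
        normX Ω T ψ ≤
          C * (Real.sqrt (sqH2 Ω (ψ 0)) + Real.sqrt (sqH1 Ω (tderiv ψ 0))
            + Real.sqrt (∫ t in (0:ℝ)..T, sqL2 Ω (f t))
            + supIcc T (fun t => Real.sqrt t * Real.sqrt (sqL2 Ω (f t)))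
            + Real.sqrt (∫ t in (0:ℝ)..T, t * (negH1 Ω (tderiv f t)) ^ 2)) := by
  obtain ⟨C, hC, hmain⟩ := main_est hd hop hbd b c k σ hb hc T R hT hR
  obtain ⟨K1, hK1, h1⟩ := sqH2_le hd hop hbd
  obtain ⟨K2, hK2, h2⟩ := poinc hd hop hbd
  set C' : ℝ := (K1 + (K2 + 1) * (1 + T) + 1) * C with hC'
  have hC'0 : 0 < C' := by positivity
  refine ⟨1, one_pos, 7 * √(C' * (1 + d ^ 2)), by positivity, ?_⟩
  intro α ψ f hα hψ hf hn _ heq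
  set d1 := √(sqH2 Ω (ψ 0)) with hd1
  set d2 := √(sqH1 Ω (tderiv ψ 0)) with hd2
  set d3 := √(∫ t in (0:ℝ)..T, sqL2 Ω (f t)) with hd3
  set d4 := supIcc T (fun t => √t * √(sqL2 Ω (f t))) with hd4
  set d5 := √(∫ t in (0:ℝ)..T, t * (negH1 Ω (tderiv f t)) ^ 2) with hd5
  have d10 : 0 ≤ d1 := sqrt_nonneg _
  have d20 : 0 ≤ d2 := sqrt_nonneg _
  have d30 : 0 ≤ d3 := sqrt_nonneg _
  have d40 : 0 ≤ d4 := supIcc_nonneg fun t => mul_nonneg (sqrt_nonneg _) (sqrt_nonneg _)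
  have d50 : 0 ≤ d5 := sqrt_nonneg _
  have hv := hψ.td
  have hw := hψ.td.td
  have ef : (fun t => sqL2 Ω (f t)) = fun t => ∫ x, f t x ^ 2 := by
    ext t; exact (hf.sm t).l2
  have hS : ∀ t ∈ Set.Icc 0 T, t * (∫ x, f t x ^ 2) ≤ d4 ^ 2 := fun t ht => by
    have cf : Continuous (fun t => √t * √(sqL2 Ω (f t))) := by
      have : Continuous (fun t => sqL2 Ω (f t)) := by rw [ef]; exact hf.sq.cint
      exact Real.continuous_sqrt.mul this.sqrt
    have := le_supIcc cf ht
    rw [← hd4, ← Real.sqrt_mul ht.1, Real.sqrt_le_left d40, (hf.sm t).l2] at this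
    exact this
  obtain ⟨m0, mq, mr, ms⟩ := hmain α ψ f hα hψ hf hn heq (d4 ^ 2) hS _ rfl
  set Z : ℝ := G (tderiv ψ 0) + L (ψ 0) + (∫ t in (0:ℝ)..T, ∫ x, f t x ^ 2) + d4 ^ 2
        + (∫ t in (0:ℝ)..T, t * negH1 Ω (tderiv f t) ^ 2) with hZ
  have i3 : 0 ≤ ∫ t in (0:ℝ)..T, ∫ x, f t x ^ 2 := int_nn hT.le fun t _ => int_sq_nonneg _
  have i5 : 0 ≤ ∫ t in (0:ℝ)..T, t * negH1 Ω (tderiv f t) ^ 2 :=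
    int_nn hT.le fun t ht => mul_nonneg ht (sq_nonneg _)
  have hZ0 : 0 ≤ Z := by
    have := G_nonneg (tderiv ψ 0)
    have := L_nonneg (ψ 0)
    rw [hZ]; positivity
  set D : ℝ := d1 + d2 + d3 + d4 + d5 with hD
  have hD0 : 0 ≤ D := by positivity
  have hZD : Z ≤ (1 + d ^ 2) * D ^ 2 := by
    have n1 : 0 ≤ sqH2 Ω (ψ 0) := by
      unfold sqH2
      rw [(hψ.sm 0).l2, (hψ.sm 0).grG]
      linarith [int_sq_nonneg (ψ 0), G_nonneg (ψ 0), sqHess_nonneg Ω (ψ 0)]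
    have n2 : 0 ≤ sqH1 Ω (tderiv ψ 0) := (G_nonneg _).trans (G_le_sqH1 (hv.sm 0))
    have s1 : L (ψ 0) ≤ d ^ 2 * d1 ^ 2 := by
      rw [hd1, Real.sq_sqrt n1]; exact lap_le_sqH2 (hψ.sm 0)
    have s2 : G (tderiv ψ 0) ≤ d2 ^ 2 := by
      rw [hd2, Real.sq_sqrt n2]; exact G_le_sqH1 (hv.sm 0)
    have s3 : (∫ t in (0:ℝ)..T, ∫ x, f t x ^ 2) = d3 ^ 2 := by
      rw [hd3, ef, Real.sq_sqrt i3]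
    have s5 : (∫ t in (0:ℝ)..T, t * negH1 Ω (tderiv f t) ^ 2) = d5 ^ 2 := by
      rw [hd5, Real.sq_sqrt i5]
    have s6 : d1 ^ 2 ≤ D ^ 2 := pow_le_pow_left₀ d10 (by linarith) 2
    have s7 : d2 ^ 2 + d3 ^ 2 + d4 ^ 2 + d5 ^ 2 ≤ D ^ 2 := by
      rw [hD]
      nlinarith [mul_nonneg d10 d20, mul_nonneg d10 d30, mul_nonneg d10 d40, mul_nonneg d10 d50,
        mul_nonneg d20 d30, mul_nonneg d20 d40, mul_nonneg d20 d50, mul_nonneg d30 d40,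
        mul_nonneg d30 d50, mul_nonneg d40 d50, sq_nonneg d1]
    have s8 : (d:ℝ) ^ 2 * d1 ^ 2 ≤ d ^ 2 * D ^ 2 := mul_le_mul_of_nonneg_left s6 (by positivity)
    rw [hZ, s3, s5]
    linarith
  set B : ℝ := √(C' * (1 + d ^ 2)) * D with hB
  have fin : ∀ y : ℝ, y ≤ C' * Z → √y ≤ B := fun y hy => by
    refine Real.sqrt_le_iff.2 ⟨by positivity, hy.trans ?_⟩
    rw [hB, mul_pow, Real.sq_sqrt (by positivity), mul_assoc C']
    exact mul_le_mul_of_nonneg_left hZD hC'0.le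
  have hCZ : 0 ≤ C * Z := mul_nonneg hC.le hZ0
  have q1 : 0 ≤ K1 * (C * Z) := mul_nonneg hK1 hCZ
  have q2 : 0 ≤ (K2 + 1) * (C * Z) := mul_nonneg (by linarith) hCZ
  have q3 : 0 ≤ (K2 + 1) * T * (C * Z) := mul_nonneg (mul_nonneg (by linarith) hT.le) hCZ
  have eC : C' * Z = K1 * (C * Z) + (K2 + 1) * (C * Z) + (K2 + 1) * T * (C * Z) + C * Z := by
    rw [hC']; ring
  have hH1 : ∀ t, sqL2 Ω (tderiv ψ t) + sqGrad Ω (tderiv ψ t) ≤ (K2 + 1) * G (tderiv ψ t) := by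
    intro t
    rw [(hv.sm t).l2, (hv.sm t).grG]
    linarith [h2 _ (hv.sm t)]
  have T0 : supIcc T (fun t => √(sqH2 Ω (ψ t))) ≤ B := supIcc_le hT fun t ht => fin _ (by
    have := h1 _ (hψ.sm t)
    have := mul_le_mul_of_nonneg_left (m0 t ht).2.1 hK1
    linarith)
  have T1 : supIcc T (fun t => √(sqH1 Ω (tderiv ψ t))) ≤ B := supIcc_le hT fun t ht => fin _ (by
    have := hH1 t
    have := mul_le_mul_of_nonneg_left (m0 t ht).1 (by linarith : 0 ≤ K2 + 1)
    unfold sqH1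
    linarith)
  have T2 : √(∫ t in (0:ℝ)..T, (sqL2 Ω (tderiv ψ t) + sqGrad Ω (tderiv ψ t)
      + sqL2 Ω (lap (tderiv ψ t)))) ≤ B := fin _ (by
    have e3 : (fun t => sqL2 Ω (tderiv ψ t) + sqGrad Ω (tderiv ψ t) + sqL2 Ω (lap (tderiv ψ t)))
        = fun t => (∫ x, tderiv ψ t x ^ 2) + G (tderiv ψ t) + L (tderiv ψ t) := by
      ext t; rw [(hv.sm t).l2, (hv.sm t).grG, (hv.sm t).lapL]
    have cA := hv.sq.cint
    have cG := hv.cG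
    have cL := hv.cL
    have key : ∫ t in (0:ℝ)..T, ((∫ x, tderiv ψ t x ^ 2) + G (tderiv ψ t) + L (tderiv ψ t))
        ≤ ∫ t in (0:ℝ)..T, ((K2 + 1) * (C * Z) + L (tderiv ψ t)) := by
      refine int_mono (by fun_prop) (by fun_prop) hT.le fun t ht => ?_
      have := h2 _ (hv.sm t)
      have := mul_le_mul_of_nonneg_left (m0 t ht).1 (by linarith : 0 ≤ K2 + 1)
      linarith
    rw [intervalIntegral.integral_add (continuous_const.intervalIntegrable _ _)
      (cL.intervalIntegrable _ _), intervalIntegral.integral_const, smul_eq_mul, sub_zero] at key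
    rw [e3]
    linarith)
  have T3 : √(∫ t in (0:ℝ)..T, sqL2 Ω (tderiv (tderiv ψ) t)) ≤ B := fin _ (by
    have e : (fun t => sqL2 Ω (tderiv (tderiv ψ) t)) = fun t => ∫ x, tderiv (tderiv ψ) t x ^ 2 := by
      ext t; exact (hw.sm t).l2
    rw [e]; linarith)
  have T4 : supIcc T (fun t => √t * √(sqL2 Ω (tderiv (tderiv ψ) t))) ≤ B :=
    supIcc_le hT fun t ht => by
      rw [← Real.sqrt_mul ht.1, (hw.sm t).l2]
      exact fin _ (by linarith [(m0 t ht).2.2.1])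
  have T5 : √(∫ t in (0:ℝ)..T, t * sqGrad Ω (tderiv (tderiv ψ) t)) ≤ B := fin _ (by
    have e : (fun t => t * sqGrad Ω (tderiv (tderiv ψ) t))
        = fun t => t * G (tderiv (tderiv ψ) t) := by
      ext t; rw [(hw.sm t).grG]
    rw [e]; linarith)
  have T6 : supIcc T (fun t => √t * √(sqL2 Ω (lap (tderiv ψ t)))) ≤ B :=
    supIcc_le hT fun t ht => by
      rw [← Real.sqrt_mul ht.1, (hv.sm t).lapL]
      exact fin _ (by linarith [(m0 t ht).2.2.2])
  unfold normX normV
  have e7 : 7 * √(C' * (1 + d ^ 2)) * D = 7 * B := by rw [hB]; ring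
  rw [e7]
  linarith

end

/-- a priori estimate for the linearized Blackstock equation
under a smallness assumption on the variable coefficient. -/
theorem linearized_blackstock_estimate (d : ℕ) (hd : d = 1 ∨ d = 2 ∨ d = 3)
    (Ω : Set (Spc d)) (hne : Ω.Nonempty) (hop : IsOpen Ω) (hbd : Bornology.IsBounded Ω)
    (b c k σ : ℝ) (hb : 0 < b) (hc : 0 < c) (T R : ℝ) (hT : 0 < T) (hR : 0 < R) :
    ∃ m > (0:ℝ), ∃ C > (0:ℝ),
      ∀ α ψ f : ℝ → Spc d → ℝ,
        Admissible Ω α → Admissible Ω ψ → Admissible Ω f →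
        normV Ω T α ≤ R →
        |k| * (supIcc T (fun t => Real.sqrt (sqL2 Ω (α t)))
            + Real.sqrt (∫ t in (0:ℝ)..T, t * sqL2 Ω (tderiv α t)))
          + |σ| * (Real.sqrt (∫ t in (0:ℝ)..T, sqGrad Ω (α t))
            + Real.sqrt (∫ t in (0:ℝ)..T, t * sqGrad Ω (tderiv α t))) ≤ m →
        (∀ t ∈ Set.Icc (0:ℝ) T, IsLinBlackstock Ω b c k σ α ψ f t) →
        normX Ω T ψ ≤
          C * (Real.sqrt (sqH2 Ω (ψ 0)) + Real.sqrt (sqH1 Ω (tderiv ψ 0))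
            + Real.sqrt (∫ t in (0:ℝ)..T, sqL2 Ω (f t))
            + supIcc T (fun t => Real.sqrt t * Real.sqrt (sqL2 Ω (f t)))
            + Real.sqrt (∫ t in (0:ℝ)..T, t * (negH1 Ω (tderiv f t)) ^ 2)) := by
  exact final_estimate d hd Ω hne hop hbd b c k σ hb hc T R hT hR
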